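/- arXiv:math/0606334 — 2 statements merged into one kernel-verified Lean document; each statement's English description precedes it below -/
import Mathlib

section
/- For p×p matrices A and B and q > 0, the singular values satisfy Σ_{i=1}^p σ_i^q(AB) ≤ Σ_{i=1}^p σ_i^q(A) σ_i^q(B), where singular values are ordered decreasingly. -/
open Matrix

section Helpers
open Module

variable {U V W : Type*} [NormedAddCommGroup U] [InnerProductSpace ℂ U]
  [FiniteDimensional ℂ U] [NormedAddCommGroup V] [InnerProductSpace ℂ V] [FiniteDimensional ℂ V]
  [NormedAddCommGroup W] [InnerProductSpace ℂ W] [FiniteDimensional ℂ W]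

theorem svp_exists_basis (f : V →ₗ[ℂ] W) :
    ∃ c : OrthonormalBasis (Fin (finrank ℂ V)) ℂ V, ∀ j,
      LinearMap.adjoint f (f (c j)) = ((f.singularValues j ^ 2 : ℝ) : ℂ) • c j := by
  refine ⟨f.isSymmetric_adjoint_comp_self.eigenvectorBasis rfl, fun j => ?_⟩
  have := f.isSymmetric_adjoint_comp_self.apply_eigenvectorBasis rfl j
  rw [f.sq_singularValues_fin rfl j]
  exact this

theorem svp_norm_sq (f : V →ₗ[ℂ] W) (c : OrthonormalBasis (Fin (finrank ℂ V)) ℂ V)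
    (hc : ∀ j, LinearMap.adjoint f (f (c j)) = ((f.singularValues j ^ 2 : ℝ) : ℂ) • c j) (x : V) :
    ‖f x‖ ^ 2 = ∑ j : Fin (finrank ℂ V), f.singularValues j ^ 2 * ‖inner ℂ (c j) x‖ ^ 2 := by
  have h1 : inner ℂ (f x) (f x) = inner ℂ x (LinearMap.adjoint f (f x)) := by
    rw [LinearMap.adjoint_inner_right]
  have h2 := c.sum_inner_mul_inner x (LinearMap.adjoint f (f x))
  have h3 : ∀ j, inner ℂ (c j) (LinearMap.adjoint f (f x)) =
      ((f.singularValues j ^ 2 : ℝ) : ℂ) * inner ℂ (c j) x := by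
    intro j
    rw [LinearMap.adjoint_inner_right, ← LinearMap.adjoint_inner_left, hc, inner_smul_left,
      Complex.conj_ofReal]
  rw [← h1, inner_self_eq_norm_sq_to_K] at h2
  apply Complex.ofReal_injective
  push_cast
  refine Eq.trans h2.symm ?_
  refine Finset.sum_congr rfl fun j _ => ?_
  rw [h3]
  have h4 : inner ℂ x (c j) * inner ℂ (c j) x = ((‖inner ℂ (c j) x‖ : ℂ)) ^ 2 := by
    rw [← inner_conj_symm x (c j)]
    exact RCLike.conj_mul _
  push_cast
  rw [← h4]; ring

theorem svp_interlace (f : V →ₗ[ℂ] W) (ι : U →ₗᵢ[ℂ] V) (i : ℕ) :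
    (f ∘ₗ ι.toLinearMap).singularValues i ≤ f.singularValues i := by
  by_cases hi : finrank ℂ U ≤ i
  · rw [LinearMap.singularValues_of_finrank_le _ hi]; exact f.singularValues_nonneg i
  push Not at hi
  set T := f ∘ₗ ι.toLinearMap with hT
  have hUV : finrank ℂ U ≤ finrank ℂ V :=
    LinearMap.finrank_le_finrank_of_injective (f := ι.toLinearMap) ι.injective
  obtain ⟨b, hb⟩ := svp_exists_basis T
  obtain ⟨c, hc⟩ := svp_exists_basis f
  let L1 : U →ₗ[ℂ] (Fin i → ℂ) := LinearMap.pi fun a =>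
    (innerₛₗ ℂ (c ⟨a, by omega⟩)) ∘ₗ ι.toLinearMap
  let L2 : U →ₗ[ℂ] (Fin (finrank ℂ U - 1 - i) → ℂ) := LinearMap.pi fun a =>
    (innerₛₗ ℂ (b ⟨i + 1 + a, by omega⟩))
  have hk : LinearMap.ker (L1.prod L2) ≠ ⊥ := by
    apply LinearMap.ker_ne_bot_of_finrank_lt
    simp
    omega
  obtain ⟨x, hx, hx0⟩ := Submodule.exists_mem_ne_zero_of_ne_bot hk
  rw [LinearMap.mem_ker, LinearMap.prod_apply] at hx
  obtain ⟨hx1, hx2⟩ := Prod.mk_eq_zero.mp hx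
  have e1 : ∀ j : Fin (finrank ℂ V), (j : ℕ) < i → inner ℂ (c j) (ι x) = 0 := fun j hj =>
    congrFun hx1 ⟨j, hj⟩
  have e2 : ∀ j : Fin (finrank ℂ U), i < (j : ℕ) → inner ℂ (b j) x = 0 := fun j hj => by
    have := congrFun hx2 ⟨j - (i + 1), by omega⟩
    have h' : (⟨i + 1 + (j - (i + 1)), by omega⟩ : Fin (finrank ℂ U)) = j := by
      ext; simp; omega
    rw [← h']; exact this
  have n1 := svp_norm_sq T b hb x
  have n2 := svp_norm_sq f c hc (ι x)
  have n3 : ‖T x‖ = ‖f (ι x)‖ := rfl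
  have p1 := b.sum_sq_norm_inner_right x
  have p2 := c.sum_sq_norm_inner_right (ι x)
  have l1 : T.singularValues i ^ 2 * ‖x‖ ^ 2 ≤ ‖T x‖ ^ 2 := by
    rw [n1, ← p1, Finset.mul_sum]
    refine Finset.sum_le_sum fun j _ => ?_
    by_cases hj : i < (j : ℕ)
    · rw [e2 j hj]; simp
    · have := T.singularValues_antitone (not_lt.mp hj)
      have := T.singularValues_nonneg i
      gcongr
  have l2 : ‖f (ι x)‖ ^ 2 ≤ f.singularValues i ^ 2 * ‖x‖ ^ 2 := by
    rw [n2, ← ι.norm_map x, ← p2, Finset.mul_sum]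
    refine Finset.sum_le_sum fun j _ => ?_
    by_cases hj : (j : ℕ) < i
    · rw [e1 j hj]; simp
    · have := f.singularValues_antitone (not_lt.mp hj)
      have := f.singularValues_nonneg j
      gcongr
  have hxp : 0 < ‖x‖ ^ 2 := by positivity
  rw [n3] at l1
  exact le_of_sq_le_sq (le_of_mul_le_mul_right (l1.trans l2) hxp) (f.singularValues_nonneg i)

theorem svp_normDet_le (f : V →ₗ[ℂ] W) (ι : U →ₗᵢ[ℂ] V) :
    (f ∘ₗ ι.toLinearMap).normDet ≤ ∏ i ∈ Finset.range (finrank ℂ U), f.singularValues i := by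
  rw [LinearMap.normDet_eq_prod_singularValues]
  exact Finset.prod_le_prod (fun i _ => LinearMap.singularValues_nonneg _ i)
    fun i _ => svp_interlace f ι i

theorem svp_attained (f : V →ₗ[ℂ] W) (k : ℕ) (hk : k ≤ finrank ℂ V) :
    ∃ ι : EuclideanSpace ℂ (Fin k) →ₗᵢ[ℂ] V,
      (f ∘ₗ ι.toLinearMap).normDet = ∏ i ∈ Finset.range k, f.singularValues i := by
  obtain ⟨c, hc⟩ := svp_exists_basis f
  let v : Fin k → V := fun a => c (Fin.castLE hk a)
  have hv : Orthonormal ℂ v := c.orthonormal.comp _ (Fin.castLE_injective hk)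
  let b := EuclideanSpace.basisFun (Fin k) ℂ
  let L : EuclideanSpace ℂ (Fin k) →ₗ[ℂ] V := b.toBasis.constr ℂ v
  have hL : ∀ a, L (b a) = v a := fun a => by
    have := b.toBasis.constr_basis ℂ v a
    simpa [L] using this
  have hL' : Orthonormal ℂ (L ∘ b.toBasis) := by
    have : (L ∘ b.toBasis) = v := by ext a; simpa using hL a
    rw [this]; exact hv
  let ι := L.isometryOfOrthonormal (v := b.toBasis) (by simpa using b.orthonormal) hL'
  refine ⟨ι, ?_⟩
  have h := LinearMap.normDet_sq_eq_det_gram (f ∘ₗ ι.toLinearMap) b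
  have hg : Matrix.gram ℂ (fun a => (f ∘ₗ ι.toLinearMap) (b a)) =
      Matrix.diagonal fun a : Fin k => ((f.singularValues a ^ 2 : ℝ) : ℂ) := by
    ext a a'
    have e : ∀ a, (f ∘ₗ ι.toLinearMap) (b a) = f (v a) := fun a => congrArg f (hL a)
    rw [Matrix.gram_apply, e, e, ← LinearMap.adjoint_inner_right, hc, inner_smul_right]
    rw [orthonormal_iff_ite.mp hv a a', Matrix.diagonal_apply]
    split_ifs with haa
    · subst haa; simp
    · simp
  rw [hg, Matrix.det_diagonal, ← Complex.ofReal_prod] at h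
  have h := Complex.ofReal_injective h
  rw [Finset.prod_pow, Fin.prod_univ_eq_prod_range (fun i => f.singularValues i) k] at h
  exact (sq_eq_sq₀ (LinearMap.normDet_nonneg _)
    (Finset.prod_nonneg fun i _ => f.singularValues_nonneg i)).mp h

theorem svp_horn {X : Type*} [NormedAddCommGroup X] [InnerProductSpace ℂ X]
    [FiniteDimensional ℂ X] (f : V →ₗ[ℂ] W) (g : W →ₗ[ℂ] X) (k : ℕ) (hk : k ≤ finrank ℂ V) :
    ∏ i ∈ Finset.range k, (g ∘ₗ f).singularValues i ≤
      ∏ i ∈ Finset.range k, (f.singularValues i * g.singularValues i) := by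
  obtain ⟨ι, hι⟩ := svp_attained (g ∘ₗ f) k hk
  rw [← hι, LinearMap.comp_assoc, LinearMap.normDet_comp, Finset.prod_mul_distrib]
  set h := f ∘ₗ ι.toLinearMap with hh
  have n1 : 0 ≤ ∏ i ∈ Finset.range k, f.singularValues i :=
    Finset.prod_nonneg fun i _ => f.singularValues_nonneg i
  have n2 : 0 ≤ ∏ i ∈ Finset.range k, g.singularValues i :=
    Finset.prod_nonneg fun i _ => g.singularValues_nonneg i
  by_cases h0 : h.normDet = 0
  · rw [h0, mul_zero]; positivity
  have hr : finrank ℂ (LinearMap.range h) = k := by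
    have := mt LinearMap.normDet_eq_zero_iff_rank_range_ne.mpr h0
    simpa using this
  have a1 := svp_normDet_le f ι
  have a2 := svp_normDet_le g (LinearMap.range h).subtypeₗᵢ
  rw [hr] at a2
  rw [finrank_euclideanSpace, Fintype.card_fin] at a1
  rw [mul_comm]
  exact mul_le_mul a1 a2 (LinearMap.normDet_nonneg _) n1

end Helpers

theorem svp_abel (c d : ℕ → ℝ) (hc : Antitone c) (n : ℕ)
    (hd : ∀ k ≤ n, 0 ≤ ∑ i ∈ Finset.range k, d i) :
    c n * ∑ i ∈ Finset.range n, d i ≤ ∑ i ∈ Finset.range n, c i * d i := by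
  induction n with
  | zero => simp
  | succ n ih =>
    have h1 := ih fun k hk => hd k (by omega)
    have h2 := hd (n + 1) le_rfl
    have h3 := mul_le_mul_of_nonneg_right (hc (Nat.le_succ n)) h2
    rw [Finset.sum_range_succ] at h2 h3 ⊢
    rw [Finset.sum_range_succ]
    simp only [Nat.succ_eq_add_one] at h3
    nlinarith

theorem svp_major (x y : ℕ → ℝ) (hx : Antitone x) (hx0 : ∀ i, 0 ≤ x i) (hy0 : ∀ i, 0 ≤ y i)
    (n : ℕ) (h : ∀ k ≤ n, ∏ i ∈ Finset.range k, x i ≤ ∏ i ∈ Finset.range k, y i) :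
    ∑ i ∈ Finset.range n, x i ≤ ∑ i ∈ Finset.range n, y i := by
  induction n with
  | zero => simp
  | succ n ih =>
    rcases (hx0 n).eq_or_lt with h0 | hpos
    · rw [Finset.sum_range_succ, Finset.sum_range_succ, ← h0]
      have := ih fun k hk => h k (by omega)
      linarith [hy0 n]
    · have hxp : ∀ i < n + 1, 0 < x i := fun i hi => hpos.trans_le (hx (by omega))
      have hpp : ∀ k ≤ n + 1, 0 < ∏ i ∈ Finset.range k, x i := fun k hk =>
        Finset.prod_pos fun i hi => hxp i (by have := Finset.mem_range.mp hi; omega)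
      have hyp : ∀ i < n + 1, 0 < y i := fun i hi => by
        refine lt_of_le_of_ne (hy0 i) fun h' => ?_
        have := (hpp (n+1) le_rfl).trans_le (h (n+1) le_rfl)
        rw [Finset.prod_eq_zero (Finset.mem_range.mpr hi) h'.symm] at this
        exact lt_irrefl _ this
      have key := svp_abel x (fun i => Real.log (y i) - Real.log (x i)) hx (n+1) (by
        intro k hk
        rw [Finset.sum_sub_distrib, ← Real.log_prod, ← Real.log_prod, sub_nonneg]
        · exact Real.log_le_log (hpp k hk) (h k hk)
        · intro i hi; exact (hxp i (by have := Finset.mem_range.mp hi; omega)).ne'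
        · intro i hi; exact (hyp i (by have := Finset.mem_range.mp hi; omega)).ne')
      have key2 : 0 ≤ x (n+1) * ∑ i ∈ Finset.range (n+1), (Real.log (y i) - Real.log (x i)) := by
        refine mul_nonneg (hx0 _) ?_
        rw [Finset.sum_sub_distrib, ← Real.log_prod, ← Real.log_prod, sub_nonneg]
        · exact Real.log_le_log (hpp _ le_rfl) (h _ le_rfl)
        · intro i hi; exact (hxp i (Finset.mem_range.mp hi)).ne'
        · intro i hi; exact (hyp i (Finset.mem_range.mp hi)).ne'
      have key3 : ∑ i ∈ Finset.range (n+1), x i * (Real.log (y i) - Real.log (x i)) ≤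
          ∑ i ∈ Finset.range (n+1), (y i - x i) := by
        refine Finset.sum_le_sum fun i hi => ?_
        have hxi := hxp i (Finset.mem_range.mp hi)
        have hyi := hyp i (Finset.mem_range.mp hi)
        rw [← Real.log_div hyi.ne' hxi.ne']
        have := Real.log_le_sub_one_of_pos (div_pos hyi hxi)
        calc x i * Real.log (y i / x i) ≤ x i * (y i / x i - 1) := by gcongr
          _ = y i - x i := by field_simp
      rw [Finset.sum_sub_distrib] at key3
      linarith

theorem svp_eig {p : ℕ} (T S : EuclideanSpace ℂ (Fin p) →ₗ[ℂ] EuclideanSpace ℂ (Fin p))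
    (h : T = S) (hT : T.IsSymmetric) (hS : S.IsSymmetric) {n : ℕ}
    (hn : Module.finrank ℂ (EuclideanSpace ℂ (Fin p)) = n) :
    hT.eigenvalues hn = hS.eigenvalues hn := by
  subst h; rfl

theorem svp_ident {p : ℕ} (A : Matrix (Fin p) (Fin p) ℂ) (σ : Fin p → ℝ) (hσ : Antitone σ)
    (hA : ∃ e : Equiv.Perm (Fin p), ∀ i,
      σ i = Real.sqrt ((Matrix.isHermitian_mul_conjTranspose_self A).eigenvalues (e i)))
    (i : Fin p) : σ i = (Matrix.toEuclideanLin Aᴴ).singularValues i := by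
  obtain ⟨e, he⟩ := hA
  set T := Matrix.toEuclideanLin Aᴴ with hT
  let s : Fin p → ℝ := fun i => T.singularValues i
  have hs : Antitone s := fun a b hab => T.singularValues_antitone hab
  let E : Fin (Fintype.card (Fin p)) ≃ Fin p := Fintype.equivOfCardEq (Fintype.card_fin _)
  let τ : Equiv.Perm (Fin p) := (e.trans E.symm).trans (finCongr (Fintype.card_fin p))
  have hTT : Matrix.toEuclideanLin (A * Aᴴ) = LinearMap.adjoint T ∘ₗ T := by
    rw [hT, ← Matrix.toEuclideanLin_conjTranspose_eq_adjoint, Matrix.conjTranspose_conjTranspose]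
    ext x : 1
    simp [Matrix.toLpLin_apply]
  have hστ : σ = s ∘ τ := by
    funext i
    rw [he]
    have h1 := T.singularValues_fin finrank_euclideanSpace (E.symm (e i))
    have h2 := svp_eig _ _ hTT (Matrix.isSymmetric_toEuclideanLin_iff.mpr
      (Matrix.isHermitian_mul_conjTranspose_self A)) T.isSymmetric_adjoint_comp_self
      finrank_euclideanSpace
    rw [← h2] at h1
    exact h1.symm
  have := Tuple.unique_antitone (f := s) (σ := τ) (τ := Equiv.refl _) (by rwa [← hστ]) hs
  rw [hστ, this]; rfl

/-- For `p×p` complex matrices `A`, `B` and `q > 0`, the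
decreasingly ordered singular values satisfy
`Σ_i σ_i(AB)^q ≤ Σ_i σ_i(A)^q σ_i(B)^q`.  Here `σA, σB, σAB` are the singular
values of `A`, `B`, `AB` (square roots of the eigenvalues of `MM*`), listed in
decreasing order. -/
theorem singular_value_power_sum_inequality
    (p : ℕ) (q : ℝ) (hq : 0 < q)
    (A B : Matrix (Fin p) (Fin p) ℂ)
    (σA σB σAB : Fin p → ℝ)
    (hσA : Antitone σA) (hσB : Antitone σB) (hσAB : Antitone σAB)
    (hA : ∃ e : Equiv.Perm (Fin p), ∀ i,
      σA i = Real.sqrt ((Matrix.isHermitian_mul_conjTranspose_self A).eigenvalues (e i)))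
    (hB : ∃ e : Equiv.Perm (Fin p), ∀ i,
      σB i = Real.sqrt ((Matrix.isHermitian_mul_conjTranspose_self B).eigenvalues (e i)))
    (hAB : ∃ e : Equiv.Perm (Fin p), ∀ i,
      σAB i = Real.sqrt ((Matrix.isHermitian_mul_conjTranspose_self (A * B)).eigenvalues (e i))) :
    ∑ i : Fin p, σAB i ^ q ≤ ∑ i : Fin p, σA i ^ q * σB i ^ q := by
  have hm : Matrix.toEuclideanLin (A * B)ᴴ =
      Matrix.toEuclideanLin Bᴴ ∘ₗ Matrix.toEuclideanLin Aᴴ := by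
    rw [Matrix.conjTranspose_mul]
    ext x : 1
    simp [Matrix.toLpLin_apply]
  have iA := svp_ident A σA hσA hA
  have iB := svp_ident B σB hσB hB
  have iAB := svp_ident (A * B) σAB hσAB hAB
  rw [hm] at iAB
  generalize Matrix.toEuclideanLin Aᴴ = f at *
  generalize Matrix.toEuclideanLin Bᴴ = g at *
  simp only [iA, iB, iAB]
  rw [Fin.sum_univ_eq_sum_range (fun i => (g ∘ₗ f).singularValues i ^ q) p,
    Fin.sum_univ_eq_sum_range (fun i => f.singularValues i ^ q * g.singularValues i ^ q) p]
  have nf := f.singularValues_nonneg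
  have ng := g.singularValues_nonneg
  have nfg := (g ∘ₗ f).singularValues_nonneg
  apply svp_major
  · intro a b hab
    exact Real.rpow_le_rpow (nfg b) ((g ∘ₗ f).singularValues_antitone hab) hq.le
  · intro i
    exact Real.rpow_nonneg (nfg i) q
  · intro i
    exact mul_nonneg (Real.rpow_nonneg (nf i) q) (Real.rpow_nonneg (ng i) q)
  · intro k hk
    have := svp_horn f g k (by simpa using hk)
    have h2 := Real.rpow_le_rpow (Finset.prod_nonneg fun i _ => nfg i) this hq.le
    rw [← Real.finsetProd_rpow _ _ (fun i _ => nfg i),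
      ← Real.finsetProd_rpow _ _ (fun i _ => mul_nonneg (nf i) (ng i))] at h2
    refine h2.trans_eq (Finset.prod_congr rfl fun i _ => Real.mul_rpow (nf i) (ng i))
end

section
/- Rakhmanov's theorem for orthogonal matrix polynomials: if ρ is a p×p positive definite matrix measure on the unit circle with Lebesgue decomposition dρ = ρ'(θ) dθ/2π + dρ_s, and det ρ'(θ) > 0 for almost every θ ∈ [0, 2π), then the matrix reflection coefficients satisfy lim_{n→∞} H_n = 0. -/
open MeasureTheory Matrix Filter Topology Complex Finset
open scoped ComplexOrder

/-- Entrywise (Bochner) integral of a matrix-valued function against a measure on `ℝ`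
(representing a matrix measure on the unit circle via the angle `θ`). -/
noncomputable def matInt {p : ℕ} (μ : Measure ℝ) (f : ℝ → Matrix (Fin p) (Fin p) ℂ) :
    Matrix (Fin p) (Fin p) ℂ :=
  Matrix.of fun i j => ∫ θ, f θ i j ∂μ

/-- Entrywise integral of a matrix-valued function over `[0, 2π]` with respect to `dθ`. -/
noncomputable def matIntI {p : ℕ} (f : ℝ → Matrix (Fin p) (Fin p) ℂ) :
    Matrix (Fin p) (Fin p) ℂ :=
  Matrix.of fun i j => ∫ θ in (0:ℝ)..(2 * Real.pi), f θ i j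

/-- The spectral norm (operator 2-norm) of a complex matrix. -/
noncomputable def sNorm {p : ℕ} (M : Matrix (Fin p) (Fin p) ℂ) : ℝ :=
  ‖LinearMap.toContinuousLinearMap (Matrix.toEuclideanLin M)‖


lemma psd_diag_re {p : ℕ} {A : Matrix (Fin p) (Fin p) ℂ} (hA : A.PosSemidef) (i : Fin p) :
    0 ≤ (A i i).re := by
  have := hA.diag_nonneg (i := i)
  exact (Complex.le_def.1 this).1

lemma psd_diag_le_trace {p : ℕ} {A : Matrix (Fin p) (Fin p) ℂ} (hA : A.PosSemidef) (i : Fin p) :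
    (A i i).re ≤ A.trace.re := by
  rw [Matrix.trace, Complex.re_sum]
  exact Finset.single_le_sum (f := fun i => (A.diag i).re) (fun j _ => psd_diag_re hA j) (Finset.mem_univ i)

lemma psd_trace_nonneg {p : ℕ} {A : Matrix (Fin p) (Fin p) ℂ} (hA : A.PosSemidef) :
    0 ≤ A.trace.re := by
  rw [Matrix.trace, Complex.re_sum]
  exact Finset.sum_nonneg (fun j _ => psd_diag_re hA j)

lemma psd_trace_im {p : ℕ} {A : Matrix (Fin p) (Fin p) ℂ} (hA : A.PosSemidef) :
    A.trace.im = 0 := by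
  have := hA.trace_nonneg
  exact (Complex.le_def.1 this).2.symm

lemma psd_entry_le {p : ℕ} {A : Matrix (Fin p) (Fin p) ℂ} (hA : A.PosSemidef) (i j : Fin p) :
    ‖A i j‖ ≤ A.trace.re := by
  obtain ⟨B, hB⟩ : ∃ B : Matrix (Fin p) (Fin p) ℂ, A = Bᴴ * B := by
    open scoped MatrixOrder in
    obtain ⟨B, hB⟩ := CStarAlgebra.nonneg_iff_eq_star_mul_self.1 (nonneg_iff_posSemidef.2 hA)
    exact ⟨B, hB⟩
  have hd : ∀ i, (A i i).re = ∑ k, ‖B k i‖ ^ 2 := by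
    intro i
    rw [hB, Matrix.mul_apply, Complex.re_sum]
    refine Finset.sum_congr rfl fun k _ => ?_
    rw [Matrix.conjTranspose_apply, Complex.star_def, ← Complex.normSq_eq_conj_mul_self,
      Complex.ofReal_re, Complex.normSq_eq_norm_sq]
  have h1 : ‖A i j‖ ≤ ((A i i).re + (A j j).re) / 2 := by
    rw [hd, hd, hB, Matrix.mul_apply, ← Finset.sum_add_distrib, Finset.sum_div]
    refine (norm_sum_le _ _).trans (Finset.sum_le_sum fun k _ => ?_)
    rw [Matrix.conjTranspose_apply, norm_mul, norm_star]
    nlinarith [sq_nonneg (‖B k i‖ - ‖B k j‖)]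
  have := psd_diag_le_trace hA i
  have := psd_diag_le_trace hA j
  linarith

lemma amgm {p : ℕ} (hp : 0 < p) (x : Fin p → ℝ) (hx : ∀ i, 0 ≤ x i) :
    (p : ℝ) * (∏ i, x i) ^ ((p : ℝ)⁻¹) ≤ ∑ i, x i := by
  have hp' : (0 : ℝ) < p := by exact_mod_cast hp
  have := Real.geom_mean_le_arith_mean Finset.univ (fun _ : Fin p => (1 : ℝ)) x
    (by simp) (by simpa using hp') (fun i _ => hx i)
  simp only [Real.rpow_one, one_mul, Finset.sum_const, Finset.card_univ, Fintype.card_fin,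
    nsmul_eq_mul, mul_one] at this
  rw [le_div_iff₀ hp'] at this
  linarith

lemma psd_det_re {p : ℕ} {A : Matrix (Fin p) (Fin p) ℂ} (hA : A.PosSemidef) :
    A.det.re = ∏ i, hA.isHermitian.eigenvalues i := by
  rw [hA.isHermitian.det_eq_prod_eigenvalues]
  have : (∏ i, ((hA.isHermitian.eigenvalues i : ℝ) : ℂ)) =
    ((∏ i, hA.isHermitian.eigenvalues i : ℝ) : ℂ) := by push_cast; rfl
  exact (congrArg Complex.re this).trans (Complex.ofReal_re _)

lemma psd_trace_re {p : ℕ} {A : Matrix (Fin p) (Fin p) ℂ} (hA : A.PosSemidef) :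
    A.trace.re = ∑ i, hA.isHermitian.eigenvalues i := by
  rw [hA.isHermitian.trace_eq_sum_eigenvalues]
  have : (∑ i, ((hA.isHermitian.eigenvalues i : ℝ) : ℂ)) =
    ((∑ i, hA.isHermitian.eigenvalues i : ℝ) : ℂ) := by push_cast; rfl
  exact (congrArg Complex.re this).trans (Complex.ofReal_re _)

lemma psd_det_re_nonneg {p : ℕ} {A : Matrix (Fin p) (Fin p) ℂ} (hA : A.PosSemidef) :
    0 ≤ A.det.re := by
  rw [psd_det_re hA]
  exact Finset.prod_nonneg fun i _ => hA.eigenvalues_nonneg i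

lemma psd_amgm {p : ℕ} (hp : 0 < p) {A : Matrix (Fin p) (Fin p) ℂ} (hA : A.PosSemidef) :
    (p : ℝ) * A.det.re ^ ((p : ℝ)⁻¹) ≤ A.trace.re := by
  rw [psd_det_re hA, psd_trace_re hA]
  exact amgm hp _ fun i => hA.eigenvalues_nonneg i

lemma psd_amgm_half {p : ℕ} (hp : 0 < p) {A : Matrix (Fin p) (Fin p) ℂ} (hA : A.PosSemidef) :
    (p : ℝ) * A.det.re ^ ((2 * p : ℝ)⁻¹) ≤ ∑ i, √(hA.isHermitian.eigenvalues i) := by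
  rw [psd_det_re hA]
  have := amgm hp (fun i => √(hA.isHermitian.eigenvalues i)) (fun i => Real.sqrt_nonneg _)
  refine le_trans (le_of_eq ?_) this
  congr 1
  have h0 : 0 ≤ ∏ i, hA.isHermitian.eigenvalues i :=
    Finset.prod_nonneg fun i _ => hA.eigenvalues_nonneg i
  have : ∏ i, √(hA.isHermitian.eigenvalues i) = √(∏ i, hA.isHermitian.eigenvalues i) := by
    rw [Real.sqrt_prod]
    exact fun i _ => hA.eigenvalues_nonneg i
  rw [this, Real.sqrt_eq_rpow, ← Real.rpow_mul h0]
  congr 1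
  rw [mul_inv]; norm_num

lemma psd_defect_nonneg {p : ℕ} (hp : 0 < p) {A : Matrix (Fin p) (Fin p) ℂ} (hA : A.PosSemidef) :
    0 ≤ A.trace.re + p - 2 * p * A.det.re ^ ((2 * p : ℝ)⁻¹) := by
  have h1 := psd_amgm_half hp hA
  have h2 : ∑ i, √(hA.isHermitian.eigenvalues i) ≤ ∑ i, (hA.isHermitian.eigenvalues i + 1) / 2 := by
    refine Finset.sum_le_sum fun i _ => ?_
    have := Real.sq_sqrt (hA.eigenvalues_nonneg i)
    nlinarith [sq_nonneg (√(hA.isHermitian.eigenvalues i) - 1)]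
  rw [← Finset.sum_div, Finset.sum_add_distrib, ← psd_trace_re hA] at h2
  simp at h2
  linarith

lemma psd_sub_one_entry {p : ℕ} (hp : 0 < p) {A : Matrix (Fin p) (Fin p) ℂ} (hA : A.PosSemidef)
    {ε : ℝ} (hε : 0 < ε) (i j : Fin p) :
    ‖(A - 1) i j‖ ≤ (2 * ε)⁻¹ * (A.trace.re + p - 2 * p * A.det.re ^ ((2 * p : ℝ)⁻¹))
      + ε * (A.trace.re + p) := by
  set l := hA.isHermitian.eigenvalues with hl
  have h1 : ‖(A - 1) i j‖ ≤ ∑ k, |l k - 1| := by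
    set U := hA.isHermitian.eigenvectorUnitary with hU
    have hsp := hA.isHermitian.spectral_theorem
    rw [Unitary.conjStarAlgAut_apply] at hsp
    have h1 : (1 : Matrix (Fin p) (Fin p) ℂ) = (U : Matrix (Fin p) (Fin p) ℂ) *
        (1 : Matrix (Fin p) (Fin p) ℂ) * star (U : Matrix (Fin p) (Fin p) ℂ) := by
      rw [mul_one]; exact (Unitary.mul_star_self_of_mem U.2).symm
    have h2 : A - 1 = (U : Matrix (Fin p) (Fin p) ℂ) *
        (diagonal (fun k => ((l k - 1 : ℝ) : ℂ))) * star (U : Matrix (Fin p) (Fin p) ℂ) := by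
      conv_lhs => rw [hsp, h1]
      rw [← sub_mul, ← mul_sub]
      congr 2
      rw [← diagonal_one, diagonal_sub]
      congr 1; ext k; simp [hl]
    rw [h2, Matrix.mul_apply]
    refine (norm_sum_le _ _).trans (Finset.sum_le_sum fun k _ => ?_)
    rw [Matrix.mul_diagonal, norm_mul, norm_mul, Matrix.star_apply, norm_star, Complex.norm_real,
      Real.norm_eq_abs]
    have a1 := entry_norm_bound_of_unitary U.2 i k
    have a2 := entry_norm_bound_of_unitary U.2 j k
    have a3 := abs_nonneg (l k - 1)
    calc _ ≤ 1 * |l k - 1| * 1 := by gcongr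
      _ = _ := by ring
  have h2 : ∀ k, |l k - 1| ≤ (2 * ε)⁻¹ * (l k + 1 - 2 * √(l k)) + ε * (l k + 1) := by
    intro k
    have h0 := hA.eigenvalues_nonneg k
    have hs := Real.sq_sqrt h0
    have hs0 := Real.sqrt_nonneg (l k)
    set s := √(l k)
    have e1 : |l k - 1| = |s - 1| * (s + 1) := by
      rw [← abs_of_nonneg (by positivity : (0:ℝ) ≤ s + 1), ← abs_mul]
      congr 1
      change hA.isHermitian.eigenvalues k - 1 = _
      rw [← hs]; ring
    rw [e1]
    have e2 : (2 * ε)⁻¹ * (l k + 1 - 2 * s) = (2 * ε)⁻¹ * |s - 1| ^ 2 := by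
      rw [sq_abs]; change _ * (hA.isHermitian.eigenvalues k + 1 - _) = _
      rw [← hs]; ring
    have e3 : (s + 1) ^ 2 ≤ 2 * (l k + 1) := by
      change _ ≤ 2 * (hA.isHermitian.eigenvalues k + 1)
      rw [← hs]; nlinarith [sq_nonneg (s - 1)]
    have e4 : |s - 1| * (s + 1) ≤ (2 * ε)⁻¹ * |s - 1| ^ 2 + ε / 2 * (s + 1) ^ 2 := by
      have : (2 * ε)⁻¹ * |s - 1| ^ 2 + ε / 2 * (s + 1) ^ 2 - |s - 1| * (s + 1)
        = (2 * ε)⁻¹ * (|s - 1| - ε * (s + 1)) ^ 2 := by field_simp; ring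
      have : 0 ≤ (2 * ε)⁻¹ * (|s - 1| - ε * (s + 1)) ^ 2 := by positivity
      linarith
    rw [e2]
    nlinarith
  have h3 := h1.trans (Finset.sum_le_sum fun k _ => h2 k)
  rw [Finset.sum_add_distrib, ← Finset.mul_sum, ← Finset.mul_sum, Finset.sum_sub_distrib,
    Finset.sum_add_distrib, ← Finset.mul_sum, ← psd_trace_re hA] at h3
  simp only [Finset.sum_const, Finset.card_univ, Fintype.card_fin, nsmul_eq_mul, mul_one] at h3
  have h4 := psd_amgm_half hp hA
  refine h3.trans ?_
  have : 0 ≤ (2 * ε)⁻¹ := by positivity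
  have h5 : (A.trace.re + p - 2 * ∑ i, √(l i)) ≤
    (A.trace.re + p - 2 * p * A.det.re ^ ((2 * p : ℝ)⁻¹)) := by linarith
  have := mul_le_mul_of_nonneg_left h5 this
  linarith

/-- The linearised Hoelder inequality. -/
lemma holder_lin {p : ℕ} (hp : 0 < p) {B : Matrix (Fin p) (Fin p) ℂ} (hB : B.PosSemidef)
    {a : ℝ} (ha : 0 ≤ a) :
    (3 / 2) * (a * B.det.re) ^ ((3 * p : ℝ)⁻¹) - (2 * p : ℝ)⁻¹ * B.trace.re
      ≤ a ^ ((2 * p : ℝ)⁻¹) := by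
  have hp' : (0 : ℝ) < p := by exact_mod_cast hp
  have hg := psd_det_re_nonneg hB
  have h1 := psd_amgm hp hB
  set g := B.det.re
  have h2 := Real.geom_mean_le_arith_mean2_weighted (w₁ := 2/3) (w₂ := 1/3)
    (p₁ := a ^ ((2 * p : ℝ)⁻¹)) (p₂ := g ^ ((p : ℝ)⁻¹)) (by norm_num) (by norm_num)
    (by positivity) (by positivity) (by norm_num)
  rw [← Real.rpow_mul ha, ← Real.rpow_mul hg] at h2
  have e1 : ((2 * p : ℝ)⁻¹) * (2/3) = (3 * p : ℝ)⁻¹ := by field_simp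
  have e2 : ((p : ℝ)⁻¹) * (1/3) = (3 * p : ℝ)⁻¹ := by field_simp
  rw [e1, e2, ← Real.mul_rpow ha hg] at h2
  have h3 : g ^ ((p : ℝ)⁻¹) ≤ (p : ℝ)⁻¹ * B.trace.re := by
    rw [← div_eq_inv_mul, le_div_iff₀ hp']; linarith
  have e3 : (2 * p : ℝ)⁻¹ * B.trace.re = 1/2 * ((p : ℝ)⁻¹ * B.trace.re) := by rw [mul_inv]; ring
  rw [e3]
  linarith


open scoped Matrix.Norms.L2Operator in
lemma sNorm_eq {p : ℕ} (M : Matrix (Fin p) (Fin p) ℂ) : sNorm M = ‖M‖ := by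
  rw [Matrix.l2_opNorm_def]; rfl

lemma unit_of_sNorm {p : ℕ} {H : Matrix (Fin p) (Fin p) ℂ} (h : sNorm H < 1) :
    IsUnit (1 - H * Hᴴ) ∧ IsUnit (1 - Hᴴ * H) := by
  rw [sNorm_eq] at h
  open scoped Matrix.Norms.L2Operator in
  have h2 : ‖Hᴴ‖ = ‖H‖ := Matrix.l2_opNorm_conjTranspose H
  have h0 : 0 ≤ ‖H‖ := norm_nonneg H
  constructor
  · apply isUnit_one_sub_of_norm_lt_one
    refine (norm_mul_le _ _).trans_lt ?_
    rw [h2]; nlinarith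
  · apply isUnit_one_sub_of_norm_lt_one
    refine (norm_mul_le _ _).trans_lt ?_
    rw [h2]; nlinarith

/-- The algebraic system behind the Szegő recurrences. -/
structure Sys {p : ℕ} (X Y : ℕ → ℂ → Matrix (Fin p) (Fin p) ℂ)
    (H SL SR : ℕ → Matrix (Fin p) (Fin p) ℂ) : Prop where
  recX : ∀ m z, SL (m + 1) * X (m + 1) z = z • X m z + H (m + 1) * Y m z
  recY : ∀ m z, SR (m + 1) * Y (m + 1) z = Y m z + z • ((H (m + 1))ᴴ * X m z)
  hL : ∀ m, (SL m)ᴴ = SL m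
  hR : ∀ m, (SR m)ᴴ = SR m
  sqL : ∀ m, SL m ^ 2 = 1 - H m * (H m)ᴴ
  sqR : ∀ m, SR m ^ 2 = 1 - (H m)ᴴ * H m
  uL : ∀ m, IsUnit (SL (m + 1))
  uR : ∀ m, IsUnit (SR (m + 1))
  init : ∀ z, (X 0 z)ᴴ * X 0 z = (Y 0 z)ᴴ * Y 0 z
  initU : ∀ z, IsUnit (Y 0 z)

lemma key_alg {p : ℕ} {X Y X' Y' H SL SR : Matrix (Fin p) (Fin p) ℂ} {z : ℂ}
    (h1 : SL * X' = z • X + H * Y) (h2 : SR * Y' = Y + z • (Hᴴ * X))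
    (hL : SLᴴ = SL) (hR : SRᴴ = SR) (sqL : SL ^ 2 = 1 - H * Hᴴ) (sqR : SR ^ 2 = 1 - Hᴴ * H)
    (uL : IsUnit SL) (uR : IsUnit SR) :
    Y'ᴴ * Y' - X'ᴴ * X' = Yᴴ * Y - ((‖z‖ ^ 2 : ℝ) : ℂ) • (Xᴴ * X) := by
  obtain ⟨u, rfl⟩ := uL
  obtain ⟨v, rfl⟩ := uR
  obtain ⟨ui, iu, ui'⟩ : ∃ ui : Matrix (Fin p) (Fin p) ℂ, ui * u = 1 ∧ u * ui = 1 :=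
    ⟨↑(u⁻¹), Units.inv_mul u, Units.mul_inv u⟩
  obtain ⟨vi, iv, vi'⟩ : ∃ vi : Matrix (Fin p) (Fin p) ℂ, vi * v = 1 ∧ v * vi = 1 :=
    ⟨↑(v⁻¹), Units.inv_mul v, Units.mul_inv v⟩
  generalize (u : Matrix (Fin p) (Fin p) ℂ) = SL at *
  generalize (v : Matrix (Fin p) (Fin p) ℂ) = SR at *
  set K : Matrix (Fin p) (Fin p) ℂ := ui * ui with hK
  set L : Matrix (Fin p) (Fin p) ℂ := vi * vi with hLd
  have uH : uiᴴ = ui := by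
    have : SL * uiᴴ = 1 := by
      have := congrArg conjTranspose iu
      rwa [conjTranspose_mul, hL, conjTranspose_one] at this
    calc uiᴴ = ui * SL * uiᴴ := by rw [iu, one_mul]
      _ = ui := by rw [mul_assoc, this, mul_one]
  have vH : viᴴ = vi := by
    have : SR * viᴴ = 1 := by
      have := congrArg conjTranspose iv
      rwa [conjTranspose_mul, hR, conjTranspose_one] at this
    calc viᴴ = vi * SR * viᴴ := by rw [iv, one_mul]
      _ = vi := by rw [mul_assoc, this, mul_one]
  have hX : X' = ui * (z • X + H * Y) := by rw [← h1, ← mul_assoc, iu, one_mul]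
  have hY : Y' = vi * (Y + z • (Hᴴ * X)) := by rw [← h2, ← mul_assoc, iv, one_mul]
  have K1 : K * (1 - H * Hᴴ) = 1 := by
    rw [← sqL, hK, pow_two, mul_assoc, ← mul_assoc ui SL, iu, one_mul, iu]
  have K2 : (1 - H * Hᴴ) * K = 1 := by
    rw [← sqL, hK, pow_two, mul_assoc, ← mul_assoc SL ui, ui', one_mul, ui']
  have L1 : L * (1 - Hᴴ * H) = 1 := by
    rw [← sqR, hLd, pow_two, mul_assoc, ← mul_assoc vi SR, iv, one_mul, iv]
  have L2 : (1 - Hᴴ * H) * L = 1 := by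
    rw [← sqR, hLd, pow_two, mul_assoc, ← mul_assoc SR vi, vi', one_mul, vi']
  have KH : K * H = H * L := by
    calc K * H = K * H * ((1 - Hᴴ * H) * L) := by rw [L2, mul_one]
      _ = K * (1 - H * Hᴴ) * H * L := by noncomm_ring
      _ = H * L := by rw [K1, one_mul]
  have LH : L * Hᴴ = Hᴴ * K := by
    calc L * Hᴴ = L * Hᴴ * ((1 - H * Hᴴ) * K) := by rw [K2, mul_one]
      _ = L * (1 - Hᴴ * H) * Hᴴ * K := by noncomm_ring
      _ = Hᴴ * K := by rw [L1, one_mul]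
  have a1 : L = 1 + Hᴴ * K * H := by
    have : L - L * Hᴴ * H = 1 := by rw [← L1, mul_sub, mul_one, mul_assoc]
    rw [LH] at this
    rw [← this]; abel
  have a2 : K = 1 + H * L * Hᴴ := by
    have : K - K * H * Hᴴ = 1 := by rw [← K1, mul_sub, mul_one, mul_assoc]
    rw [KH] at this
    rw [← this]; abel
  have e1 : X'ᴴ * X' = (z • X + H * Y)ᴴ * K * (z • X + H * Y) := by
    rw [hX, conjTranspose_mul, uH, hK]; simp only [mul_assoc]
  have e2 : Y'ᴴ * Y' = (Y + z • (Hᴴ * X))ᴴ * L * (Y + z • (Hᴴ * X)) := by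
    rw [hY, conjTranspose_mul, vH, hLd]; simp only [mul_assoc]
  have hz : ((‖z‖ ^ 2 : ℝ) : ℂ) = star z * z := by
    rw [Complex.star_def, ← Complex.normSq_eq_conj_mul_self, Complex.normSq_eq_norm_sq]
  rw [e1, e2, hz]
  simp only [conjTranspose_add, conjTranspose_smul, conjTranspose_mul, conjTranspose_conjTranspose,
    add_mul, mul_add, smul_mul_assoc, mul_smul_comm, smul_smul, smul_add]
  have b1 : Xᴴ * H * L * Y = Xᴴ * K * (H * Y) := by
    rw [← mul_assoc (Xᴴ * K) H Y, mul_assoc Xᴴ K H, KH, ← mul_assoc Xᴴ H L]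
  have b2 : Yᴴ * L * (Hᴴ * X) = Yᴴ * Hᴴ * K * X := by
    rw [← mul_assoc, mul_assoc Yᴴ L, LH, ← mul_assoc]
  have b3 : Yᴴ * L * Y = Yᴴ * Y + Yᴴ * Hᴴ * K * (H * Y) := by
    rw [a1]; noncomm_ring
  have b4 : Xᴴ * K * X = Xᴴ * X + Xᴴ * H * L * (Hᴴ * X) := by
    rw [a2]; noncomm_ring
  rw [b1, b2, b3, b4]
  simp only [smul_add, mul_comm z (star z)]
  abel

lemma Sys.disc {p : ℕ} {X Y : ℕ → ℂ → Matrix (Fin p) (Fin p) ℂ}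
    {H SL SR : ℕ → Matrix (Fin p) (Fin p) ℂ} (S : Sys X Y H SL SR) {z : ℂ} (hz : ‖z‖ ≤ 1) (n : ℕ) :
    ((Y n z)ᴴ * Y n z - (X n z)ᴴ * X n z).PosSemidef ∧ IsUnit (Y n z) := by
  induction n with
  | zero => 
    refine ⟨?_, S.initU z⟩
    rw [S.init, sub_self]; exact PosSemidef.zero
  | succ n ih =>
    have hk := key_alg (S.recX n z) (S.recY n z) (S.hL _) (S.hR _) (S.sqL _) (S.sqR _) (S.uL _) (S.uR _)
    have hpsd : ((Y (n+1) z)ᴴ * Y (n+1) z - (X (n+1) z)ᴴ * X (n+1) z).PosSemidef := by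
      rw [hk]
      have : (Y n z)ᴴ * Y n z - ((‖z‖ ^ 2 : ℝ) : ℂ) • ((X n z)ᴴ * X n z) =
        ((Y n z)ᴴ * Y n z - (X n z)ᴴ * X n z) + ((1 - ‖z‖ ^ 2 : ℝ) : ℂ) • ((X n z)ᴴ * X n z) := by
        push_cast; rw [sub_smul, one_smul]; abel
      rw [this]
      refine ih.1.add ((posSemidef_conjTranspose_mul_self _).smul ?_)
      rw [Complex.zero_le_real]
      nlinarith [norm_nonneg z]
    refine ⟨hpsd, ?_⟩
    rw [Matrix.isUnit_iff_isUnit_det, isUnit_iff_ne_zero]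
    intro hdet
    obtain ⟨v, hv0, hv⟩ := Matrix.exists_mulVec_eq_zero_iff.2 hdet
    have hXv : X (n+1) z *ᵥ v = 0 := by
      have h1 := hpsd.dotProduct_mulVec_nonneg v
      rw [sub_mulVec, ← mulVec_mulVec, ← mulVec_mulVec, hv, mulVec_zero, zero_sub, dotProduct_neg] at h1
      have h2 : star v ⬝ᵥ (X (n+1) z)ᴴ *ᵥ (X (n+1) z *ᵥ v) = star (X (n+1) z *ᵥ v) ⬝ᵥ (X (n+1) z *ᵥ v) := by
        rw [star_mulVec, ← dotProduct_mulVec]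
      rw [h2] at h1
      have h3 := dotProduct_star_self_nonneg (X (n+1) z *ᵥ v)
      have h4 := dotProduct_star_self_eq_zero (v := X (n+1) z *ᵥ v)
      rw [dotProduct_comm] at h3 h4
      exact h4.1 (le_antisymm (by rw [dotProduct_comm]; simpa using h1) h3)
    have r1 := congrArg (· *ᵥ v) (S.recX n z)
    have r2 := congrArg (· *ᵥ v) (S.recY n z)
    simp only [← mulVec_mulVec, add_mulVec, smul_mulVec, hXv, hv, mulVec_zero] at r1 r2
    have hY1 : Y n z *ᵥ v = - (z • ((H (n+1))ᴴ *ᵥ (X n z *ᵥ v))) := eq_neg_of_add_eq_zero_left r2.symm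
    have hX1 : SL (n+1) *ᵥ (SL (n+1) *ᵥ (z • (X n z *ᵥ v))) = 0 := by
      rw [mulVec_mulVec, ← pow_two, S.sqL, sub_mulVec, one_mulVec, ← mulVec_mulVec, mulVec_smul, mulVec_smul]
      rw [hY1, mulVec_neg, mulVec_smul] at r1
      rw [r1]; abel
    have hinj : Function.Injective (SL (n+1)).mulVec := Matrix.mulVec_injective_of_isUnit (S.uL n)
    have hX2 : z • (X n z *ᵥ v) = 0 := by
      apply hinj; apply hinj; rw [hX1, mulVec_zero, mulVec_zero]
    have hY2 : Y n z *ᵥ v = 0 := by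
      rw [hY1, ← mulVec_smul, hX2, mulVec_zero, neg_zero]
    exact hv0 (Matrix.mulVec_injective_of_isUnit ih.2 (by rw [hY2, mulVec_zero]))

lemma Sys.circle {p : ℕ} {X Y : ℕ → ℂ → Matrix (Fin p) (Fin p) ℂ}
    {H SL SR : ℕ → Matrix (Fin p) (Fin p) ℂ} (S : Sys X Y H SL SR) {z : ℂ} (hz : ‖z‖ = 1) (n : ℕ) :
    (X n z)ᴴ * X n z = (Y n z)ᴴ * Y n z := by
  induction n with
  | zero => exact S.init z
  | succ n ih =>
    have hk := key_alg (S.recX n z) (S.recY n z) (S.hL _) (S.hR _) (S.sqL _) (S.sqR _) (S.uL _) (S.uR _)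
    rw [ih, hz] at hk
    simp at hk
    exact (sub_eq_zero.1 hk).symm

/-- `U = X Y⁻¹` is a contraction; entrywise bound. -/
lemma Sys.U_entry {p : ℕ} {X Y : ℕ → ℂ → Matrix (Fin p) (Fin p) ℂ}
    {H SL SR : ℕ → Matrix (Fin p) (Fin p) ℂ} (S : Sys X Y H SL SR) {z : ℂ} (hz : ‖z‖ = 1) (n : ℕ)
    (i j : Fin p) : ‖(X n z * (Y n z)⁻¹) i j‖ ≤ 1 := by
  apply entry_norm_bound_of_unitary
  rw [Matrix.mem_unitaryGroup_iff']
  have hu := (Matrix.isUnit_iff_isUnit_det _).1 (S.disc hz.le n).2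
  rw [star_eq_conjTranspose, conjTranspose_mul, mul_assoc, ← mul_assoc _ (X n z), S.circle hz n,
    mul_assoc, Matrix.mul_nonsing_inv _ hu, mul_one, ← conjTranspose_mul, Matrix.mul_nonsing_inv _ hu,
    conjTranspose_one]


/-- normalised Lebesgue measure on `(0, 2π]` -/
noncomputable def tau : Measure ℝ :=
  ENNReal.ofReal ((2 * Real.pi)⁻¹) • (volume.restrict (Set.Ioc (0:ℝ) (2 * Real.pi)))

instance tau_prob : IsProbabilityMeasure tau := by
  constructor
  rw [tau, Measure.smul_apply, Measure.restrict_apply MeasurableSet.univ, Set.univ_inter,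
    Real.volume_Ioc, sub_zero, smul_eq_mul, ← ENNReal.ofReal_mul (by positivity)]
  rw [inv_mul_cancel₀ (by positivity), ENNReal.ofReal_one]

lemma matIntI_eq {p : ℕ} (f : ℝ → Matrix (Fin p) (Fin p) ℂ) :
    (2 * Real.pi : ℝ)⁻¹ • matIntI f = matInt tau f := by
  ext i j
  simp only [matIntI, matInt, Matrix.smul_apply, Matrix.of_apply, tau, integral_smul_measure]
  rw [intervalIntegral.integral_of_le (by positivity), ENNReal.toReal_ofReal (by positivity)]

lemma integral_tau (f : ℝ → ℂ) :
    ∫ θ, f θ ∂tau = (2 * Real.pi : ℝ)⁻¹ • ∫ θ in (0:ℝ)..(2 * Real.pi), f θ := by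
  simp only [tau, integral_smul_measure]
  rw [intervalIntegral.integral_of_le (by positivity), ENNReal.toReal_ofReal (by positivity)]

def MI {p : ℕ} (μ : Measure ℝ) (F : ℝ → Matrix (Fin p) (Fin p) ℂ) : Prop :=
  ∀ i j, Integrable (fun θ => F θ i j) μ

def BC {p : ℕ} (F : ℝ → Matrix (Fin p) (Fin p) ℂ) : Prop :=
  Continuous F ∧ ∃ C : ℝ, ∀ θ i j, ‖F θ i j‖ ≤ C

section
variable {p : ℕ} {μ : Measure ℝ} {F G V : ℝ → Matrix (Fin p) (Fin p) ℂ}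

lemma BC.cont (h : BC F) (i j) : Continuous fun θ => F θ i j := h.1.matrix_elem i j

lemma BC.mul (hF : BC F) (hG : BC G) : BC (fun θ => F θ * G θ) := by
  obtain ⟨c1, C, hC⟩ := hF
  obtain ⟨c2, D, hD⟩ := hG
  refine ⟨c1.matrix_mul c2, ∑ _k : Fin p, C * D, fun θ i j => ?_⟩
  show ‖(F θ * G θ) i j‖ ≤ _
  rw [Matrix.mul_apply]
  refine (norm_sum_le _ _).trans (Finset.sum_le_sum fun k _ => ?_)
  rw [norm_mul]
  exact mul_le_mul (hC _ _ _) (hD _ _ _) (norm_nonneg _) ((norm_nonneg _).trans (hC θ i k))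

lemma BC.star (hF : BC F) : BC (fun θ => (F θ)ᴴ) := by
  obtain ⟨c1, C, hC⟩ := hF
  refine ⟨c1.matrix_conjTranspose, C, fun θ i j => ?_⟩
  show ‖(F θ)ᴴ i j‖ ≤ _
  rw [Matrix.conjTranspose_apply, norm_star]; exact hC _ _ _

lemma BC.smul (hF : BC F) {f : ℝ → ℂ} (hf : Continuous f) (hf1 : ∀ θ, ‖f θ‖ ≤ 1) :
    BC (fun θ => f θ • F θ) := by
  obtain ⟨c1, C, hC⟩ := hF
  refine ⟨hf.smul c1, C, fun θ i j => ?_⟩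
  show ‖(f θ • F θ) i j‖ ≤ _
  rw [Matrix.smul_apply, norm_smul]
  calc _ ≤ 1 * ‖F θ i j‖ := by gcongr; exact hf1 θ
    _ ≤ C := by rw [one_mul]; exact hC _ _ _

lemma BC.MI_mul (hF : BC F) (hV : MI μ V) : MI μ (fun θ => F θ * V θ) := by
  intro i j
  obtain ⟨c1, C, hC⟩ := hF
  simp only [Matrix.mul_apply]
  refine integrable_finsetSum _ fun k _ => ?_
  exact (hV k j).bdd_mul (c := C) ((c1.matrix_elem i k).aestronglyMeasurable)
    (Filter.Eventually.of_forall fun θ => hC θ i k)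

lemma BC.mul_MI (hF : BC F) (hV : MI μ V) : MI μ (fun θ => V θ * F θ) := by
  intro i j
  obtain ⟨c1, C, hC⟩ := hF
  simp only [Matrix.mul_apply]
  refine integrable_finsetSum _ fun k _ => ?_
  exact (hV i k).mul_bdd (c := C) ((c1.matrix_elem k j).aestronglyMeasurable)
    (Filter.Eventually.of_forall fun θ => hC θ k j)

lemma BC.MI [IsFiniteMeasure μ] (hF : BC F) : MI μ F := by
  intro i j
  obtain ⟨c1, C, hC⟩ := hF
  exact Integrable.of_bound ((c1.matrix_elem i j).aestronglyMeasurable) C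
    (Filter.Eventually.of_forall fun θ => hC θ i j)

lemma MI.add (hF : MI μ F) (hG : MI μ G) : MI μ (fun θ => F θ + G θ) :=
  fun i j => (hF i j).add (hG i j)
lemma MI.sub (hF : MI μ F) (hG : MI μ G) : MI μ (fun θ => F θ - G θ) :=
  fun i j => (hF i j).sub (hG i j)
lemma MI.star (hF : MI μ F) : MI μ (fun θ => (F θ)ᴴ) := fun i j => by
  simp only [Matrix.conjTranspose_apply]
  exact (Complex.conjCLE.toContinuousLinearMap).integrable_comp (hF j i)
lemma MI.const_mul (C : Matrix (Fin p) (Fin p) ℂ) (hF : MI μ F) : MI μ (fun θ => C * F θ) := by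
  intro i j
  simp only [Matrix.mul_apply]
  exact integrable_finsetSum _ fun k _ => (hF k j).const_mul _
lemma MI.mul_const (C : Matrix (Fin p) (Fin p) ℂ) (hF : MI μ F) : MI μ (fun θ => F θ * C) := by
  intro i j
  simp only [Matrix.mul_apply]
  exact integrable_finsetSum _ fun k _ => (hF i k).mul_const _
lemma MI.smul (hF : MI μ F) {f : ℝ → ℂ} (hf : Continuous f) (hf1 : ∀ θ, ‖f θ‖ ≤ 1) :
    MI μ (fun θ => f θ • F θ) := fun i j => by
  simp only [Matrix.smul_apply, smul_eq_mul]
  exact (hF i j).bdd_mul (c := 1) hf.aestronglyMeasurable (Filter.Eventually.of_forall hf1)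
lemma MI.sum {ι : Type*} (s : Finset ι) {F : ι → ℝ → Matrix (Fin p) (Fin p) ℂ}
    (hF : ∀ k ∈ s, MI μ (F k)) : MI μ (fun θ => ∑ k ∈ s, F k θ) := fun i j => by
  simp only [Matrix.sum_apply]
  exact integrable_finsetSum _ fun k hk => hF k hk i j
lemma MI.trace (hF : MI μ F) : Integrable (fun θ => (F θ).trace) μ := by
  simp only [Matrix.trace]
  exact integrable_finsetSum _ fun k _ => hF k k

lemma matInt_add (hF : MI μ F) (hG : MI μ G) :
    matInt μ (fun θ => F θ + G θ) = matInt μ F + matInt μ G := by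
  ext i j; exact integral_add (hF i j) (hG i j)
lemma matInt_sub (hF : MI μ F) (hG : MI μ G) :
    matInt μ (fun θ => F θ - G θ) = matInt μ F - matInt μ G := by
  ext i j; exact integral_sub (hF i j) (hG i j)
lemma matInt_star : matInt μ (fun θ => (F θ)ᴴ) = (matInt μ F)ᴴ := by
  ext i j
  simp only [matInt, Matrix.of_apply, Matrix.conjTranspose_apply, Complex.star_def]
  exact integral_conj
lemma matInt_const_mul (C : Matrix (Fin p) (Fin p) ℂ) (hF : MI μ F) :
    matInt μ (fun θ => C * F θ) = C * matInt μ F := by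
  ext i j
  simp only [matInt, Matrix.of_apply, Matrix.mul_apply]
  rw [integral_finsetSum _ fun k _ => (hF k j).const_mul _]
  exact Finset.sum_congr rfl fun k _ => integral_const_mul _ _
lemma matInt_mul_const (C : Matrix (Fin p) (Fin p) ℂ) (hF : MI μ F) :
    matInt μ (fun θ => F θ * C) = matInt μ F * C := by
  ext i j
  simp only [matInt, Matrix.of_apply, Matrix.mul_apply]
  rw [integral_finsetSum _ fun k _ => (hF i k).mul_const _]
  exact Finset.sum_congr rfl fun k _ => integral_mul_const _ _
lemma matInt_sum {ι : Type*} (s : Finset ι) {F : ι → ℝ → Matrix (Fin p) (Fin p) ℂ}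
    (hF : ∀ k ∈ s, MI μ (F k)) :
    matInt μ (fun θ => ∑ k ∈ s, F k θ) = ∑ k ∈ s, matInt μ (F k) := by
  ext i j
  simp only [matInt, Matrix.of_apply, Matrix.sum_apply]
  exact integral_finsetSum _ fun k hk => hF k hk i j
lemma matInt_trace (hF : MI μ F) : (matInt μ F).trace = ∫ θ, (F θ).trace ∂μ := by
  simp only [Matrix.trace, matInt, Matrix.diag, Matrix.of_apply]
  rw [integral_finsetSum _ fun k _ => hF k k]
lemma matInt_congr (h : ∀ θ, F θ = G θ) : matInt μ F = matInt μ G := by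
  rw [funext h]
lemma matInt_add_measure {μ' : Measure ℝ} (hF : MI μ F) (hF' : MI μ' F) :
    matInt (μ + μ') F = matInt μ F + matInt μ' F := by
  ext i j; exact integral_add_measure (hF i j) (hF' i j)
end

/-- holomorphic near the closed disc -/
def HD {p : ℕ} (f : ℂ → Matrix (Fin p) (Fin p) ℂ) : Prop :=
  ∀ z, ‖z‖ ≤ 1 → ∀ i j, DifferentiableAt ℂ (fun z => f z i j) z

section
variable {p : ℕ} {f g : ℂ → Matrix (Fin p) (Fin p) ℂ}

lemma HD.mul (hf : HD f) (hg : HD g) : HD (fun z => f z * g z) := by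
  intro z hz i j
  simp only [Matrix.mul_apply]
  exact DifferentiableAt.fun_sum fun k _ => (hf z hz i k).mul (hg z hz k j)

lemma HD.pow_smul (hf : HD f) (k : ℕ) : HD (fun z => z ^ k • f z) := by
  intro z hz i j
  simp only [Matrix.smul_apply, smul_eq_mul]
  exact (differentiableAt_id.pow k).mul (hf z hz i j)

lemma HD.inv (hf : HD f) (hu : ∀ z, ‖z‖ ≤ 1 → IsUnit (f z)) : HD (fun z => (f z)⁻¹) := by
  intro z hz i j
  open scoped Matrix.Norms.L2Operator in
  have h1 : DifferentiableAt ℂ f z := by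
    have : f = fun z => ∑ i, ∑ j, f z i j • Matrix.single i j (1:ℂ) := by
      funext z
      conv_lhs => rw [matrix_eq_sum_single (f z)]
      simp
    rw [this]
    refine DifferentiableAt.fun_sum fun i _ => DifferentiableAt.fun_sum fun j _ => ?_
    exact (hf z hz i j).smul_const _
  have h2 : DifferentiableAt ℂ (fun z => Ring.inverse (f z)) z :=
    (differentiableAt_inverse (𝕜 := ℂ) (hu z hz)).comp z h1
  simp only [Matrix.nonsing_inv_eq_ringInverse]
  let ev : Matrix (Fin p) (Fin p) ℂ →L[ℂ] ℂ :=
    LinearMap.toContinuousLinearMap (Matrix.entryLinearMap ℂ ℂ i j)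
  exact ev.differentiableAt.comp z h2

noncomputable abbrev ee (θ : ℝ) : ℂ := Complex.exp (θ * Complex.I)

lemma ee_norm (θ : ℝ) : ‖ee θ‖ = 1 := Complex.norm_exp_ofReal_mul_I θ
lemma ee_ne (θ : ℝ) : ee θ ≠ 0 := Complex.exp_ne_zero _
lemma ee_cont : Continuous ee := by unfold ee; fun_prop

lemma HD.bc (hf : HD f) : BC (fun θ => f (ee θ)) := by
  have hc : ∀ i j, ContinuousOn (fun z => f z i j) (Metric.sphere 0 1) := fun i j z hz =>
    (hf z (by simpa using (mem_sphere_zero_iff_norm.1 hz).le) i j).continuousAt.continuousWithinAt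
  refine ⟨?_, ?_⟩
  · refine continuous_matrix fun i j => ?_
    exact (hc i j).comp_continuous ee_cont fun θ => by simp [ee_norm]
  · have : ∀ i j, ∃ C, ∀ z ∈ Metric.sphere (0:ℂ) 1, ‖f z i j‖ ≤ C := fun i j =>
      (isCompact_sphere 0 1).exists_bound_of_continuousOn (hc i j)
    choose C hC using this
    refine ⟨∑ i, ∑ j, |C i j|, fun θ i j => ?_⟩
    have h1 := hC i j (ee θ) (by simp [ee_norm])
    refine h1.trans ((le_abs_self _).trans ?_)
    refine le_trans ?_ (Finset.single_le_sum (f := fun i => ∑ j, |C i j|)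
      (fun i _ => Finset.sum_nonneg fun j _ => abs_nonneg _) (Finset.mem_univ i))
    exact Finset.single_le_sum (f := fun j => |C i j|) (fun j _ => abs_nonneg _) (Finset.mem_univ j)

lemma HD.mv (hf : HD f) : matInt tau (fun θ => f (ee θ)) = f 0 := by
  ext i j
  simp only [matInt, Matrix.of_apply]
  rw [integral_tau]
  have h : DiffContOnCl ℂ (fun z => f z i j) (Metric.ball 0 |1|) := by
    refine DifferentiableOn.diffContOnCl (s := Metric.ball 0 |1|) fun z hz => ?_
    rw [abs_one, closure_ball _ one_ne_zero] at hz
    exact (hf z (by simpa using hz) i j).differentiableWithinAt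
  have := h.circleAverage
  rw [Real.circleAverage_def] at this
  simpa [circleMap] using this

lemma HD.mv_zero (hf : HD f) {k : ℕ} (hk : 1 ≤ k) :
    matInt tau (fun θ => ee θ ^ k • f (ee θ)) = 0 := by
  have := (hf.pow_smul k).mv
  rw [this, zero_pow (by omega), zero_smul]

lemma HD.poly (n : ℕ) (a : ℕ → Matrix (Fin p) (Fin p) ℂ) (e : ℕ → ℕ) :
    HD (fun z => ∑ j ∈ range n, z ^ (e j) • a j) := by
  intro z hz i j
  simp only [Matrix.sum_apply, Matrix.smul_apply, smul_eq_mul]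
  exact DifferentiableAt.fun_sum fun k _ => (differentiableAt_id.pow _).mul_const _
end


section
variable {p : ℕ}

lemma rev_eq (m : ℕ) (a : ℕ → Matrix (Fin p) (Fin p) ℂ) {z : ℂ} (hz : z ≠ 0) :
    (∑ j ∈ range (m + 1), z ^ (m - j) • (a j)ᴴ) =
      z ^ m • (∑ j ∈ range (m + 1), ((star z)⁻¹) ^ j • a j)ᴴ := by
  rw [Matrix.conjTranspose_sum, Finset.smul_sum]
  refine Finset.sum_congr rfl fun j hj => ?_
  have hj' : j ≤ m := by have := Finset.mem_range.1 hj; omega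
  rw [Matrix.conjTranspose_smul, smul_smul]
  congr 1
  rw [star_pow, star_inv₀, star_star, inv_pow, ← div_eq_mul_inv, pow_sub₀ z hz hj', div_eq_mul_inv]

lemma rev_circle (m : ℕ) (a : ℕ → Matrix (Fin p) (Fin p) ℂ) {z : ℂ} (hz : ‖z‖ = 1) :
    (∑ j ∈ range (m + 1), z ^ (m - j) • (a j)ᴴ) =
      z ^ m • (∑ j ∈ range (m + 1), z ^ j • a j)ᴴ := by
  have h0 : z ≠ 0 := by rintro rfl; simp at hz
  rw [rev_eq m a h0]
  have : (star z)⁻¹ = z := by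
    rw [Complex.star_def, ← Complex.inv_eq_conj hz, inv_inv]
  rw [this]

lemma rev_rec {P Q Pt Qt : ℕ → ℂ → Matrix (Fin p) (Fin p) ℂ}
    {a b : ℕ → ℕ → Matrix (Fin p) (Fin p) ℂ} {S K : ℕ → Matrix (Fin p) (Fin p) ℂ}
    (hP : ∀ m z, P m z = ∑ j ∈ range (m + 1), z ^ j • a m j)
    (hQ : ∀ m z, Q m z = ∑ j ∈ range (m + 1), z ^ j • b m j)
    (hPt : ∀ m z, Pt m z = ∑ j ∈ range (m + 1), z ^ (m - j) • (a m j)ᴴ)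
    (hQt : ∀ m z, Qt m z = ∑ j ∈ range (m + 1), z ^ (m - j) • (b m j)ᴴ)
    (hS : ∀ m, (S m)ᴴ = S m)
    (hrec : ∀ m z, P (m + 1) z * S (m + 1) = z • P m z + Qt m z * K (m + 1)) (m : ℕ) (z : ℂ) :
    S (m + 1) * Pt (m + 1) z = Pt m z + z • ((K (m + 1))ᴴ * Q m z) := by
  have key : ∀ z : ℂ, z ≠ 0 →
      S (m + 1) * Pt (m + 1) z = Pt m z + z • ((K (m + 1))ᴴ * Q m z) := by
    intro z hz
    set w : ℂ := (star z)⁻¹ with hw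
    have hw0 : w ≠ 0 := by simp [hw, hz]
    have hsw : star w = z⁻¹ := by simp [hw, star_inv₀]
    have e1 : ∀ k, Pt k z = z ^ k • (P k w)ᴴ := fun k => by rw [hPt, hP, rev_eq k (a k) hz]
    have e2 : Qt m w = w ^ m • (Q m z)ᴴ := by
      rw [hQt, hQ, rev_eq m (b m) hw0, hsw, inv_inv]
    have h := congrArg Matrix.conjTranspose (hrec m w)
    rw [Matrix.conjTranspose_mul, hS, Matrix.conjTranspose_add, Matrix.conjTranspose_smul,
      Matrix.conjTranspose_mul, e2, Matrix.conjTranspose_smul, Matrix.conjTranspose_conjTranspose,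
      star_pow, hsw] at h
    rw [e1, e1, Matrix.mul_smul, h, smul_add, smul_smul, Matrix.mul_smul, smul_smul]
    have a1 : z ^ (m + 1) * z⁻¹ = z ^ m := by rw [pow_succ, mul_assoc, mul_inv_cancel₀ hz, mul_one]
    have a2 : z ^ (m + 1) * z⁻¹ ^ m = z := by rw [pow_succ, mul_right_comm, ← mul_pow, mul_inv_cancel₀ hz, one_pow, one_mul]
    rw [a1, a2]
  have cP : ∀ k, Continuous (Pt k) := fun k => by
    have : Pt k = fun z => ∑ j ∈ range (k + 1), z ^ (k - j) • (a k j)ᴴ := funext (hPt k)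
    rw [this]; fun_prop
  have cQ : ∀ k, Continuous (Q k) := fun k => by
    have : Q k = fun z => ∑ j ∈ range (k + 1), z ^ j • b k j := funext (hQ k)
    rw [this]; fun_prop
  have := Continuous.ext_on (dense_compl_singleton (0:ℂ))
    (f := fun z => S (m + 1) * Pt (m + 1) z)
    (g := fun z => Pt m z + z • ((K (m + 1))ᴴ * Q m z))
    (continuous_const.matrix_mul (cP _))
    ((cP _).add (continuous_id.smul (continuous_const.matrix_mul (cQ _))))
    (fun z hz => key z (by simpa using hz))
  exact congrFun this z

/-- unified data -/
structure Dat (μs : Measure ℝ) (V : ℝ → Matrix (Fin p) (Fin p) ℂ) (N : Set ℝ)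
    (X Y Xt : ℕ → ℂ → Matrix (Fin p) (Fin p) ℂ) (a b : ℕ → ℕ → Matrix (Fin p) (Fin p) ℂ)
    (H SL SR : ℕ → Matrix (Fin p) (Fin p) ℂ) : Prop where
  fin : IsFiniteMeasure μs
  supp : μs (Set.Ico (0:ℝ) (2 * Real.pi))ᶜ = 0
  mN : MeasurableSet N
  tN : tau N = 0
  sN : μs Nᶜ = 0
  psd : ∀ θ, (V θ).PosSemidef
  miT : MI tau V
  miS : MI μs V
  det : ∀ᵐ θ ∂tau, 0 < ((V θ).det).re
  S : Sys X Y H SL SR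
  hX : ∀ m z, X m z = ∑ j ∈ range (m + 1), z ^ j • a m j
  hY : ∀ m z, Y m z = ∑ j ∈ range (m + 1), z ^ (m - j) • b m j
  ua : ∀ m, IsUnit (a m m)
  hXt : ∀ m, HD (Xt m)
  uXt : ∀ m z, ‖z‖ ≤ 1 → IsUnit (Xt m z)
  cXt : ∀ m z, ‖z‖ = 1 → Xt m z = z ^ m • (X m z)ᴴ
  orX : ∀ k m, matInt (tau + μs) (fun θ => X k (ee θ) * V θ * (X m (ee θ))ᴴ) =
    if k = m then 1 else 0
  orY : ∀ m, matInt (tau + μs) (fun θ => Y m (ee θ) * V θ * (Y m (ee θ))ᴴ) = 1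

lemma MI.congr {μ : Measure ℝ} {F G : ℝ → Matrix (Fin p) (Fin p) ℂ} (h : MI μ F)
    (hFG : F =ᵐ[μ] G) : MI μ G := fun i j =>
  (h i j).congr (by filter_upwards [hFG] with θ hθ; rw [hθ])

lemma matInt_congr_ae {μ : Measure ℝ} {F G : ℝ → Matrix (Fin p) (Fin p) ℂ}
    (hFG : F =ᵐ[μ] G) : matInt μ F = matInt μ G := by
  ext i j
  exact integral_congr_ae (by filter_upwards [hFG] with θ hθ; rw [hθ])

lemma unit_of_sq {A B : Matrix (Fin p) (Fin p) ℂ} (h : A ^ 2 = B) (hB : IsUnit B) : IsUnit A := by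
  rw [← h] at hB
  exact (isUnit_pow_iff (by norm_num)).1 hB

theorem mkDat
    (W' : ℝ → Matrix (Fin p) (Fin p) ℂ)
    (hW' : ∀ θ, (W' θ).PosSemidef)
    (hW'int : ∀ i j, IntervalIntegrable (fun θ => W' θ i j)
      MeasureTheory.volume 0 (2 * Real.pi))
    (μs : Measure ℝ) [IsFiniteMeasure μs]
    (hsupp : μs (Set.Ico (0:ℝ) (2 * Real.pi))ᶜ = 0)
    (hsing : μs ⟂ₘ (MeasureTheory.volume : Measure ℝ))
    (Ws : ℝ → Matrix (Fin p) (Fin p) ℂ)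
    (hWs : ∀ θ, (Ws θ).PosSemidef)
    (hWsint : ∀ i j, Integrable (fun θ => Ws θ i j) μs)
    (aL aR : ℕ → ℕ → Matrix (Fin p) (Fin p) ℂ)
    (φL φR φLt φRt : ℕ → ℂ → Matrix (Fin p) (Fin p) ℂ)
    (hφL : ∀ m z, φL m z = ∑ j ∈ range (m + 1), z ^ j • aL m j)
    (hφR : ∀ m z, φR m z = ∑ j ∈ range (m + 1), z ^ j • aR m j)
    (hφLt : ∀ m z, φLt m z = ∑ j ∈ range (m + 1), z ^ (m - j) • (aL m j)ᴴ)
    (hφRt : ∀ m z, φRt m z = ∑ j ∈ range (m + 1), z ^ (m - j) • (aR m j)ᴴ)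
    (hLlead : ∀ m, IsUnit (aL m m)) (hRlead : ∀ m, IsUnit (aR m m))
    (horthL : ∀ k m,
      (2 * Real.pi : ℝ)⁻¹ • matIntI (fun θ =>
        φL k (Complex.exp (θ * Complex.I)) * W' θ *
          (φL m (Complex.exp (θ * Complex.I)))ᴴ) +
      matInt μs (fun θ =>
        φL k (Complex.exp (θ * Complex.I)) * Ws θ *
          (φL m (Complex.exp (θ * Complex.I)))ᴴ) = if k = m then 1 else 0)
    (horthR : ∀ k m,
      (2 * Real.pi : ℝ)⁻¹ • matIntI (fun θ =>
        (φR k (Complex.exp (θ * Complex.I)))ᴴ * W' θ *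
          φR m (Complex.exp (θ * Complex.I))) +
      matInt μs (fun θ =>
        (φR k (Complex.exp (θ * Complex.I)))ᴴ * Ws θ *
          φR m (Complex.exp (θ * Complex.I))) = if k = m then 1 else 0)
    (H SL SR : ℕ → Matrix (Fin p) (Fin p) ℂ)
    (hHnorm : ∀ m, 1 ≤ m → sNorm (H m) < 1)
    (hSLherm : ∀ m, (SL m)ᴴ = SL m) (hSRherm : ∀ m, (SR m)ᴴ = SR m)
    (hSLsq : ∀ m, SL m ^ 2 = 1 - H m * (H m)ᴴ)
    (hSRsq : ∀ m, SR m ^ 2 = 1 - (H m)ᴴ * H m)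
    (hrecL : ∀ m z, SL (m + 1) * φL (m + 1) z = z • φL m z + H (m + 1) * φRt m z)
    (hrecR : ∀ m z, φR (m + 1) z * SR (m + 1) = z • φR m z + φLt m z * H (m + 1))
    (hdet : ∀ᵐ θ ∂(MeasureTheory.volume.restrict (Set.Ico (0:ℝ) (2 * Real.pi))),
      0 < ((W' θ).det).re) :
    ∃ V N, Dat μs V N φL φRt φLt aL (fun m j => (aR m j)ᴴ) H SL SR := by
  classical
  obtain ⟨M, hM, hM1, hM2⟩ := hsing
  have hN : MeasurableSet Mᶜ := hM.compl
  have tN : tau Mᶜ = 0 := by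
    rw [tau, Measure.smul_apply]
    have : (volume.restrict (Set.Ioc (0:ℝ) (2 * Real.pi))) Mᶜ ≤ 0 :=
      (Measure.restrict_apply_le _ _).trans hM2.le
    rw [le_antisymm this (zero_le), smul_zero]
  have sN : μs (Mᶜ)ᶜ = 0 := by rw [compl_compl]; exact hM1
  set V : ℝ → Matrix (Fin p) (Fin p) ℂ := fun θ => if θ ∈ Mᶜ then Ws θ else W' θ with hV
  have aeT : W' =ᵐ[tau] V := by
    have : ∀ᵐ θ ∂tau, θ ∉ Mᶜ := measure_eq_zero_iff_ae_notMem.1 tN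
    filter_upwards [this] with θ hθ
    simp only [hV, if_neg hθ]
  have aeS : Ws =ᵐ[μs] V := by
    have : ∀ᵐ θ ∂μs, θ ∉ (Mᶜ)ᶜ := measure_eq_zero_iff_ae_notMem.1 sN
    filter_upwards [this] with θ hθ
    simp only [hV, if_pos (not_not.1 hθ)]
  have miW : MI tau W' := fun i j => by
    have := (intervalIntegrable_iff_integrableOn_Ioc_of_le (by positivity)).1 (hW'int i j)
    exact Integrable.smul_measure this (by simp)
  have miT : MI tau V := miW.congr aeT
  have miS : MI μs V := MI.congr hWsint aeS
  -- polynomials are BC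
  have bcL : ∀ m, BC (fun θ => φL m (ee θ)) := fun m => by
    have : φL m = fun z => ∑ j ∈ range (m + 1), z ^ j • aL m j := funext (hφL m)
    rw [this]; exact (HD.poly (m + 1) (aL m) (fun j => j)).bc
  have bcR : ∀ m, BC (fun θ => φR m (ee θ)) := fun m => by
    have : φR m = fun z => ∑ j ∈ range (m + 1), z ^ j • aR m j := funext (hφR m)
    rw [this]; exact (HD.poly (m + 1) (aR m) (fun j => j)).bc
  have orL : ∀ k m, matInt (tau + μs) (fun θ => φL k (ee θ) * V θ * (φL m (ee θ))ᴴ) =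
      if k = m then 1 else 0 := by
    intro k m
    rw [matInt_add_measure ((bcL m).star.mul_MI ((bcL k).MI_mul miT))
      ((bcL m).star.mul_MI ((bcL k).MI_mul miS)), ← horthL k m, matIntI_eq]
    congr 1
    · refine matInt_congr_ae ?_
      filter_upwards [aeT] with θ hθ; rw [hθ]
    · refine matInt_congr_ae ?_
      filter_upwards [aeS] with θ hθ; rw [hθ]
  have orR : ∀ k m, matInt (tau + μs) (fun θ => (φR k (ee θ))ᴴ * V θ * (φR m (ee θ))) =
      if k = m then 1 else 0 := by
    intro k m
    rw [matInt_add_measure ((bcR m).mul_MI ((bcR k).star.MI_mul miT))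
      ((bcR m).mul_MI ((bcR k).star.MI_mul miS)), ← horthR k m, matIntI_eq]
    congr 1
    · refine matInt_congr_ae ?_
      filter_upwards [aeT] with θ hθ; rw [hθ]
    · refine matInt_congr_ae ?_
      filter_upwards [aeS] with θ hθ; rw [hθ]
  -- initial relation
  have hM0 : MI (tau + μs) V := fun i j => (miT i j).add_measure (miS i j)
  have i1 : aL 0 0 * matInt (tau + μs) V * (aL 0 0)ᴴ = 1 := by
    have := orL 0 0
    simp only [hφL, zero_add, Finset.range_one, Finset.sum_singleton, pow_zero, one_smul,
      if_true] at this
    rw [matInt_mul_const _ (hM0.const_mul _), matInt_const_mul _ hM0] at this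
    exact this
  have i2 : (aR 0 0)ᴴ * matInt (tau + μs) V * (aR 0 0) = 1 := by
    have := orR 0 0
    simp only [hφR, zero_add, Finset.range_one, Finset.sum_singleton, pow_zero, one_smul,
      if_true] at this
    rw [matInt_mul_const _ (hM0.const_mul _), matInt_const_mul _ hM0] at this
    exact this
  have i3 : (aL 0 0)ᴴ * aL 0 0 = aR 0 0 * (aR 0 0)ᴴ := by
    set Q := matInt (tau + μs) V
    have e1 : Q * ((aL 0 0)ᴴ * aL 0 0) = 1 := by
      rw [← Matrix.mul_assoc]
      apply mul_eq_one_comm.1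
      rw [← Matrix.mul_assoc]; exact i1
    have e2 : (aR 0 0 * (aR 0 0)ᴴ) * Q = 1 := by
      rw [Matrix.mul_assoc]
      exact mul_eq_one_comm.1 i2
    calc (aL 0 0)ᴴ * aL 0 0 = ((aR 0 0 * (aR 0 0)ᴴ) * Q) * ((aL 0 0)ᴴ * aL 0 0) := by
          rw [e2, one_mul]
      _ = _ := by rw [Matrix.mul_assoc, e1, mul_one]
  have u1 : ∀ m, IsUnit (SL (m + 1)) := fun m =>
    unit_of_sq (hSLsq (m + 1)) (unit_of_sNorm (hHnorm (m + 1) (by omega))).1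
  have u2 : ∀ m, IsUnit (SR (m + 1)) := fun m =>
    unit_of_sq (hSRsq (m + 1)) (unit_of_sNorm (hHnorm (m + 1) (by omega))).2
  have S : Sys φL φRt H SL SR := by
    refine ⟨hrecL, rev_rec hφR hφL hφRt hφLt hSRherm hrecR, hSLherm, hSRherm, hSLsq, hSRsq,
      u1, u2, fun z => ?_, fun z => ?_⟩
    · simp [hφL, hφRt, i3]
    · simpa [hφRt] using (hRlead 0).star
  have tr_unit : ∀ {A : Matrix (Fin p) (Fin p) ℂ}, IsUnit A → IsUnit Aᵀ := fun h => by
    rw [Matrix.isUnit_iff_isUnit_det, Matrix.det_transpose]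
    exact (Matrix.isUnit_iff_isUnit_det _).1 h
  have S' : Sys (fun m z => (φR m z)ᵀ) (fun m z => (φLt m z)ᵀ) (fun m => (H m)ᵀ)
      (fun m => (SR m)ᵀ) (fun m => (SL m)ᵀ) := by
    have tc : ∀ A : Matrix (Fin p) (Fin p) ℂ, (Aᵀ)ᴴ = (Aᴴ)ᵀ := fun A => by ext i j; simp
    refine ⟨fun m z => ?_, ?_, fun m => ?_, fun m => ?_, fun m => ?_, fun m => ?_,
      fun m => tr_unit (u2 m), fun m => tr_unit (u1 m), fun z => ?_, fun z => ?_⟩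
    · rw [← Matrix.transpose_mul, hrecR, Matrix.transpose_add, Matrix.transpose_smul,
        Matrix.transpose_mul]
    · refine rev_rec (P := fun m z => (φL m z)ᵀ) (Pt := fun m z => (φLt m z)ᵀ) (Q := fun m z => (φR m z)ᵀ)
        (Qt := fun m z => (φRt m z)ᵀ) (a := fun m j => (aL m j)ᵀ) (b := fun m j => (aR m j)ᵀ)
        (S := fun m => (SL m)ᵀ) (K := fun m => (H m)ᵀ) ?_ ?_ ?_ ?_ ?_ ?_
      · intro m z; simp [hφL, Matrix.transpose_sum]
      · intro m z; simp [hφR, Matrix.transpose_sum]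
      · intro m z; simp [hφLt, Matrix.transpose_sum, tc]
      · intro m z; simp [hφRt, Matrix.transpose_sum, tc]
      · intro m; rw [tc, hSLherm]
      · intro m z
        rw [← Matrix.transpose_mul, hrecL, Matrix.transpose_add, Matrix.transpose_smul,
          Matrix.transpose_mul]
    · rw [tc, hSRherm]
    · rw [tc, hSLherm]
    · rw [← Matrix.transpose_pow, hSRsq, tc, ← Matrix.transpose_mul, Matrix.transpose_sub,
        Matrix.transpose_one]
    · rw [← Matrix.transpose_pow, hSLsq, tc, ← Matrix.transpose_mul, Matrix.transpose_sub,
        Matrix.transpose_one]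
    · rw [tc, tc, ← Matrix.transpose_mul, ← Matrix.transpose_mul]
      simp [hφR, hφLt, i3]
    · refine tr_unit ?_
      simpa [hφLt] using (hLlead 0).star
  refine ⟨V, Mᶜ, inferInstance, hsupp, hN, tN, sN, ?_, miT, miS, ?_, S, hφL, hφRt, hLlead, ?_, ?_,
    ?_, orL, ?_⟩
  · intro θ
    simp only [hV]; split_ifs; exacts [hWs θ, hW' θ]
  · have h1 : ∀ᵐ θ ∂tau, 0 < ((W' θ).det).re := by
      rw [Measure.restrict_congr_set Ico_ae_eq_Ioc] at hdet
      exact Measure.smul_absolutelyContinuous.ae_le hdet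
    filter_upwards [h1, aeT] with θ h h'
    rwa [← h']
  · intro m
    have : φLt m = fun z => ∑ j ∈ range (m + 1), z ^ (m - j) • (aL m j)ᴴ := funext (hφLt m)
    rw [this]; exact HD.poly (m + 1) (fun j => (aL m j)ᴴ) (fun j => m - j)
  · intro m z hz
    have := (S'.disc hz m).2
    have h2 := tr_unit this
    rwa [Matrix.transpose_transpose] at h2
  · intro m z hz
    rw [hφLt, hφL, rev_circle m (aL m) hz]
  · intro m
    have := orR m m
    rw [if_pos rfl] at this
    rw [← this]
    refine matInt_congr fun θ => ?_
    have e : φRt m (ee θ) = (ee θ) ^ m • (φR m (ee θ))ᴴ := by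
      rw [hφRt, hφR, rev_circle m (aR m) (ee_norm θ)]
    rw [e, Matrix.conjTranspose_smul, Matrix.conjTranspose_conjTranspose, Matrix.smul_mul,
      Matrix.smul_mul, Matrix.mul_smul, smul_smul]
    have : ee θ ^ m * star (ee θ ^ m) = 1 := by
      rw [Complex.star_def, Complex.mul_conj, Complex.normSq_eq_norm_sq, norm_pow, ee_norm]; simp
    rw [this, one_smul]
end


section
variable {p : ℕ}

lemma ee_pow_norm (θ : ℝ) (j : ℕ) : ‖ee θ ^ j‖ ≤ 1 := by rw [norm_pow, ee_norm, one_pow]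
lemma eestar_pow_norm (θ : ℝ) (j : ℕ) : ‖star (ee θ ^ j)‖ ≤ 1 := by
  rw [norm_star]; exact ee_pow_norm θ j
lemma ee_pow_cont (j : ℕ) : Continuous (fun θ => ee θ ^ j) := ee_cont.pow j
lemma eestar_pow_cont (j : ℕ) : Continuous (fun θ => star (ee θ ^ j)) := (ee_cont.pow j).star
lemma ee_mul_star (θ : ℝ) (m : ℕ) : ee θ ^ m * star (ee θ ^ m) = 1 := by
  rw [Complex.star_def, Complex.mul_conj, Complex.normSq_eq_norm_sq, norm_pow, ee_norm]; simp

lemma matInt_mul_polyStar {μ : Measure ℝ} {F : ℝ → Matrix (Fin p) (Fin p) ℂ} (hF : MI μ F)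
    (n : ℕ) (c : ℕ → Matrix (Fin p) (Fin p) ℂ) (e : ℕ → ℕ) :
    matInt μ (fun θ => F θ * (∑ i ∈ range n, ee θ ^ (e i) • c i)ᴴ) =
      ∑ i ∈ range n, matInt μ (fun θ => star (ee θ ^ (e i)) • F θ) * (c i)ᴴ := by
  have h : ∀ i, MI μ (fun θ => star (ee θ ^ (e i)) • F θ) := fun i =>
    hF.smul (eestar_pow_cont _) (fun θ => eestar_pow_norm θ _)
  rw [← Finset.sum_congr rfl fun i _ => matInt_mul_const (c i)ᴴ (h i),
    ← matInt_sum _ fun i _ => (h i).mul_const _]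
  refine matInt_congr fun θ => ?_
  rw [Matrix.conjTranspose_sum, Finset.mul_sum]
  refine Finset.sum_congr rfl fun i _ => ?_
  rw [Matrix.conjTranspose_smul, Matrix.mul_smul, Matrix.smul_mul]

lemma matInt_poly_mul {μ : Measure ℝ} {F : ℝ → Matrix (Fin p) (Fin p) ℂ} (hF : MI μ F)
    (n : ℕ) (c : ℕ → Matrix (Fin p) (Fin p) ℂ) :
    matInt μ (fun θ => (∑ i ∈ range n, ee θ ^ i • c i) * F θ) =
      ∑ i ∈ range n, c i * matInt μ (fun θ => ee θ ^ i • F θ) := by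
  have h : ∀ i, MI μ (fun θ => ee θ ^ i • F θ) := fun i =>
    hF.smul (ee_pow_cont _) (fun θ => ee_pow_norm θ _)
  rw [← Finset.sum_congr rfl fun i _ => matInt_const_mul (c i) (h i),
    ← matInt_sum _ fun i _ => (h i).const_mul _]
  refine matInt_congr fun θ => ?_
  rw [Finset.sum_mul]
  refine Finset.sum_congr rfl fun i _ => ?_
  rw [Matrix.mul_smul, Matrix.smul_mul]

lemma unit_cancel_right {A B : Matrix (Fin p) (Fin p) ℂ} (hB : IsUnit B) (h : A * B = 0) :
    A = 0 := (IsUnit.mul_left_eq_zero hB).1 h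
lemma unit_cancel_left {A B : Matrix (Fin p) (Fin p) ℂ} (hA : IsUnit A) (h : A * B = 0) :
    B = 0 := (IsUnit.mul_right_eq_zero hA).1 h

lemma moments_unique {a : ℕ → ℕ → Matrix (Fin p) (Fin p) ℂ} (ua : ∀ m, IsUnit (a m m))
    {M M' : ℕ → Matrix (Fin p) (Fin p) ℂ} {n : ℕ} (h0 : M 0 = M' 0)
    (h : ∀ k, 1 ≤ k → k ≤ n → ∑ j ∈ range (k + 1), a k j * M j = 0)
    (h' : ∀ k, 1 ≤ k → k ≤ n → ∑ j ∈ range (k + 1), a k j * M' j = 0) :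
    ∀ k, k ≤ n → M k = M' k := by
  intro k
  induction k using Nat.strong_induction_on with
  | _ k ih =>
    intro hk
    rcases Nat.eq_zero_or_pos k with rfl | hk0
    · exact h0
    · have e1 := h k hk0 hk
      have e2 := h' k hk0 hk
      rw [Finset.sum_range_succ] at e1 e2
      have e3 : ∑ j ∈ range k, a k j * M j = ∑ j ∈ range k, a k j * M' j :=
        Finset.sum_congr rfl fun j hj => by
          have := Finset.mem_range.1 hj
          rw [ih j this (by omega)]
      rw [e3] at e1
      have e4 : a k k * M k = a k k * M' k := by
        rw [← e2] at e1; exact add_left_cancel e1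
      have : a k k * (M k - M' k) = 0 := by rw [mul_sub, e4, sub_self]
      exact sub_eq_zero.1 (unit_cancel_left (ua k) this)

variable {μs : Measure ℝ} {V : ℝ → Matrix (Fin p) (Fin p) ℂ} {N : Set ℝ}
    {X Y Xt : ℕ → ℂ → Matrix (Fin p) (Fin p) ℂ} {a b : ℕ → ℕ → Matrix (Fin p) (Fin p) ℂ}
    {H SL SR : ℕ → Matrix (Fin p) (Fin p) ℂ}

namespace Dat

lemma miV (D : Dat μs V N X Y Xt a b H SL SR) : MI (tau + μs) V :=
  fun i j => (D.miT i j).add_measure (D.miS i j)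

lemma hdX (D : Dat μs V N X Y Xt a b H SL SR) (m : ℕ) : HD (X m) := by
  rw [funext (D.hX m)]; exact HD.poly (m + 1) (a m) (fun j => j)
lemma hdY (D : Dat μs V N X Y Xt a b H SL SR) (m : ℕ) : HD (Y m) := by
  rw [funext (D.hY m)]; exact HD.poly (m + 1) (b m) (fun j => m - j)
lemma uY (D : Dat μs V N X Y Xt a b H SL SR) (m : ℕ) {z : ℂ} (hz : ‖z‖ ≤ 1) : IsUnit (Y m z) :=
  (D.S.disc hz m).2
lemma hdYi (D : Dat μs V N X Y Xt a b H SL SR) (m : ℕ) : HD (fun z => (Y m z)⁻¹) :=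
  (D.hdY m).inv fun _ hz => D.uY m hz
lemma X0 (D : Dat μs V N X Y Xt a b H SL SR) (z : ℂ) : X 0 z = a 0 0 := by simp [D.hX]
lemma Y0 (D : Dat μs V N X Y Xt a b H SL SR) (z : ℂ) : Y 0 z = b 0 0 := by simp [D.hY]

lemma orth_pow (D : Dat μs V N X Y Xt a b H SL SR) (n j : ℕ) (hj : j ≤ n) :
    matInt (tau + μs) (fun θ => star (ee θ ^ j) • (X (n + 1) (ee θ) * V θ)) = 0 := by
  induction j using Nat.strong_induction_on with
  | _ j ih =>
    have h := D.orX (n + 1) j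
    rw [if_neg (by omega)] at h
    have hF : MI (tau + μs) (fun θ => X (n + 1) (ee θ) * V θ) := (D.hdX (n + 1)).bc.MI_mul D.miV
    simp only [D.hX j] at h
    rw [matInt_mul_polyStar hF (j + 1) (a j) (fun i => i), Finset.sum_range_succ] at h
    rw [Finset.sum_eq_zero, zero_add] at h
    · exact unit_cancel_right (D.ua j).star h
    · intro i hi
      have := Finset.mem_range.1 hi
      rw [ih i this (by omega), Matrix.zero_mul]

lemma orth_Y (D : Dat μs V N X Y Xt a b H SL SR) (n : ℕ) :
    matInt (tau + μs) (fun θ => X (n + 1) (ee θ) * V θ * (Y n (ee θ))ᴴ) = 0 := by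
  have hF : MI (tau + μs) (fun θ => X (n + 1) (ee θ) * V θ) := (D.hdX (n + 1)).bc.MI_mul D.miV
  simp only [D.hY n]
  rw [matInt_mul_polyStar hF (n + 1) (b n) (fun i => n - i)]
  exact Finset.sum_eq_zero fun i hi => by rw [D.orth_pow n (n - i) (by omega), Matrix.zero_mul]

lemma H_formula (D : Dat μs V N X Y Xt a b H SL SR) (n : ℕ) :
    - H (n + 1) = matInt (tau + μs) (fun θ => (ee θ • (X n (ee θ) * (Y n (ee θ))⁻¹)) *
      (Y n (ee θ) * V θ * (Y n (ee θ))ᴴ)) := by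
  have hF : MI (tau + μs) (fun θ => X (n + 1) (ee θ) * V θ * (Y n (ee θ))ᴴ) :=
    (D.hdY n).bc.star.mul_MI ((D.hdX (n + 1)).bc.MI_mul D.miV)
  have hG : MI (tau + μs) (fun θ => Y n (ee θ) * V θ * (Y n (ee θ))ᴴ) :=
    (D.hdY n).bc.star.mul_MI ((D.hdY n).bc.MI_mul D.miV)
  have h1 := matInt_const_mul (SL (n + 1)) hF
  have h2 := matInt_const_mul (H (n + 1)) hG
  rw [D.orth_Y, Matrix.mul_zero] at h1
  rw [D.orY, Matrix.mul_one] at h2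
  have h3 := matInt_sub (hF.const_mul (SL (n + 1))) (hG.const_mul (H (n + 1)))
  rw [h1, h2, zero_sub] at h3
  rw [← h3]
  refine matInt_congr fun θ => ?_
  have hu := (Matrix.isUnit_iff_isUnit_det _).1 (D.uY n (ee_norm θ).le)
  have e : X n (ee θ) * (Y n (ee θ))⁻¹ * (Y n (ee θ)) = X n (ee θ) := by
    rw [Matrix.mul_assoc, Matrix.nonsing_inv_mul _ hu, Matrix.mul_one]
  rw [Matrix.smul_mul, ← Matrix.mul_assoc, ← Matrix.mul_assoc, ← Matrix.mul_assoc,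
    ← Matrix.mul_assoc, ← Matrix.mul_assoc (X n (ee θ) * (Y n (ee θ))⁻¹),
    ← Matrix.mul_assoc (X n (ee θ) * (Y n (ee θ))⁻¹), e, D.S.recX]
  simp only [Matrix.add_mul, Matrix.smul_mul, Matrix.mul_assoc]
  abel

/-- the Bernstein–Szegő weight -/
noncomputable def w (Y : ℕ → ℂ → Matrix (Fin p) (Fin p) ℂ) (n : ℕ) (θ : ℝ) :
    Matrix (Fin p) (Fin p) ℂ := (Y n (ee θ))⁻¹ * ((Y n (ee θ))⁻¹)ᴴ

lemma w_bc (D : Dat μs V N X Y Xt a b H SL SR) (n : ℕ) : BC (w Y n) :=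
  (D.hdYi n).bc.mul (D.hdYi n).bc.star

lemma base_Y (D : Dat μs V N X Y Xt a b H SL SR) (n j : ℕ) :
    matInt tau (fun θ => star (ee θ ^ j) • (Y n (ee θ) * w Y n θ)) =
      (matInt tau (fun θ => ee θ ^ j • (Y n (ee θ))⁻¹))ᴴ := by
  rw [← matInt_star]
  refine matInt_congr fun θ => ?_
  have hu := (Matrix.isUnit_iff_isUnit_det _).1 (D.uY n (ee_norm θ).le)
  rw [w, ← Matrix.mul_assoc, Matrix.mul_nonsing_inv _ hu, Matrix.one_mul,
    Matrix.conjTranspose_smul]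

lemma base_X (D : Dat μs V N X Y Xt a b H SL SR) (n j : ℕ) (hj : j < n) :
    matInt tau (fun θ => star (ee θ ^ j) • (X n (ee θ) * w Y n θ)) = 0 := by
  have hd : HD (fun z => (Xt n z)⁻¹) := (D.hXt n).inv (D.uXt n)
  rw [← hd.mv_zero (k := n - j) (by omega)]
  refine matInt_congr fun θ => ?_
  have hu := (Matrix.isUnit_iff_isUnit_det _).1 (D.uY n (ee_norm θ).le)
  have hc := D.S.circle (ee_norm θ) n
  have hx := D.cXt n (ee θ) (ee_norm θ)
  have hxu := (Matrix.isUnit_iff_isUnit_det _).1 (D.uXt n (ee θ) (ee_norm θ).le)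
  have key : Xt n (ee θ) * (X n (ee θ) * w Y n θ) = ee θ ^ n • 1 := by
    rw [hx, Matrix.smul_mul, ← Matrix.mul_assoc, hc, w]
    congr 1
    rw [Matrix.mul_assoc, ← Matrix.mul_assoc (Y n (ee θ)), Matrix.mul_nonsing_inv _ hu,
      Matrix.one_mul, ← Matrix.conjTranspose_mul, Matrix.nonsing_inv_mul _ hu,
      Matrix.conjTranspose_one]
  have k2 : X n (ee θ) * w Y n θ = ee θ ^ n • (Xt n (ee θ))⁻¹ := by
    have := congrArg (fun M => (Xt n (ee θ))⁻¹ * M) key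
    simp only [← Matrix.mul_assoc, Matrix.nonsing_inv_mul _ hxu, Matrix.one_mul] at this
    rw [Matrix.mul_smul, Matrix.mul_one] at this
    exact this
  rw [k2, smul_smul]
  congr 1
  have e1 := ee_mul_star θ j
  have e2 : ee θ ^ n = ee θ ^ (n - j) * ee θ ^ j := by rw [← pow_add]; congr 1; omega
  rw [e2, mul_comm, mul_assoc, e1, mul_one]

lemma desc (D : Dat μs V N X Y Xt a b H SL SR) (n d : ℕ) : ∀ k, k + d = n →
    (∀ j, j < k → matInt tau (fun θ => star (ee θ ^ j) • (X k (ee θ) * w Y n θ)) = 0) ∧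
    (∀ j, 1 ≤ j → j ≤ k → matInt tau (fun θ => star (ee θ ^ j) • (Y k (ee θ) * w Y n θ)) = 0) ∧
    matInt tau (fun θ => Y k (ee θ) * w Y n θ) = ((Y k 0)⁻¹)ᴴ := by
  induction d with
  | zero =>
    intro k hk
    obtain rfl : k = n := by omega
    refine ⟨fun j hj => D.base_X k j hj, fun j hj _ => ?_, ?_⟩
    · rw [D.base_Y, (D.hdYi k).mv_zero hj, Matrix.conjTranspose_zero]
    · have := D.base_Y k 0
      simp only [pow_zero, star_one, one_smul] at this
      rw [this, (D.hdYi k).mv]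
  | succ d ih =>
    intro k hk
    obtain ⟨i1, i2, i3⟩ := ih (k + 1) (by omega)
    have mi : ∀ (F : ℂ → Matrix (Fin p) (Fin p) ℂ), HD F → ∀ j,
        MI tau (fun θ => star (ee θ ^ j) • (F (ee θ) * w Y n θ)) := fun F hF j =>
      ((hF.bc.mul (D.w_bc n)).smul (eestar_pow_cont j) (fun θ => eestar_pow_norm θ j)).MI
    have hSL : SL (k + 1) * SL (k + 1) = 1 - H (k + 1) * (H (k + 1))ᴴ := by
      rw [← D.S.sqL, sq]
    have hSR : SR (k + 1) * SR (k + 1) = 1 - (H (k + 1))ᴴ * H (k + 1) := by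
      rw [← D.S.sqR, sq]
    have rX : ∀ z, SL (k + 1) * X (k + 1) z - H (k + 1) * SR (k + 1) * Y (k + 1) z =
        z • (SL (k + 1) * SL (k + 1) * X k z) := fun z => by
      rw [Matrix.mul_assoc (H (k + 1)), D.S.recX, D.S.recY, hSL]
      simp only [Matrix.mul_add, Matrix.sub_mul, Matrix.one_mul, Matrix.mul_smul,
        Matrix.mul_assoc, smul_sub]
      abel
    have rY : ∀ z, SR (k + 1) * Y (k + 1) z - (H (k + 1))ᴴ * SL (k + 1) * X (k + 1) z =
        SR (k + 1) * SR (k + 1) * Y k z := fun z => by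
      rw [Matrix.mul_assoc (H (k + 1))ᴴ, D.S.recX, D.S.recY, hSR]
      simp only [Matrix.mul_add, Matrix.sub_mul, Matrix.one_mul, Matrix.mul_smul,
        Matrix.mul_assoc]
      abel
    -- integrated identities
    have IY : ∀ j, SR (k + 1) * SR (k + 1) *
        matInt tau (fun θ => star (ee θ ^ j) • (Y k (ee θ) * w Y n θ)) =
        SR (k + 1) * matInt tau (fun θ => star (ee θ ^ j) • (Y (k + 1) (ee θ) * w Y n θ)) -
        (H (k + 1))ᴴ * SL (k + 1) *
          matInt tau (fun θ => star (ee θ ^ j) • (X (k + 1) (ee θ) * w Y n θ)) := fun j => by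
      rw [← matInt_const_mul _ (mi _ (D.hdY k) j), ← matInt_const_mul _ (mi _ (D.hdY (k + 1)) j),
        ← matInt_const_mul _ (mi _ (D.hdX (k + 1)) j),
        ← matInt_sub ((mi _ (D.hdY (k + 1)) j).const_mul _) ((mi _ (D.hdX (k + 1)) j).const_mul _)]
      refine matInt_congr fun θ => ?_
      rw [Matrix.mul_smul, Matrix.mul_smul, Matrix.mul_smul, ← smul_sub, ← Matrix.mul_assoc,
        ← rY, ← Matrix.mul_assoc, ← Matrix.mul_assoc, Matrix.sub_mul]
    have IX : ∀ j, SL (k + 1) * SL (k + 1) *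
        matInt tau (fun θ => star (ee θ ^ j) • (X k (ee θ) * w Y n θ)) =
        SL (k + 1) * matInt tau (fun θ => star (ee θ ^ (j + 1)) • (X (k + 1) (ee θ) * w Y n θ)) -
        H (k + 1) * SR (k + 1) *
          matInt tau (fun θ => star (ee θ ^ (j + 1)) • (Y (k + 1) (ee θ) * w Y n θ)) := fun j => by
      rw [← matInt_const_mul _ (mi _ (D.hdX k) j),
        ← matInt_const_mul _ (mi _ (D.hdY (k + 1)) (j + 1)),
        ← matInt_const_mul _ (mi _ (D.hdX (k + 1)) (j + 1)),
        ← matInt_sub ((mi _ (D.hdX (k + 1)) (j + 1)).const_mul _)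
          ((mi _ (D.hdY (k + 1)) (j + 1)).const_mul _)]
      refine matInt_congr fun θ => ?_
      rw [Matrix.mul_smul, Matrix.mul_smul, Matrix.mul_smul, ← smul_sub,
        ← Matrix.mul_assoc (SL (k + 1)) (X (k + 1) (ee θ)),
        ← Matrix.mul_assoc (H (k + 1) * SR (k + 1)), ← Matrix.sub_mul, rX, Matrix.smul_mul,
        smul_smul, ← Matrix.mul_assoc]
      congr 1
      rw [pow_succ, star_mul', mul_assoc]
      have := ee_mul_star θ 1
      rw [pow_one] at this
      rw [mul_comm (star (ee θ)), this, mul_one]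
    have uLL : IsUnit (SL (k + 1) * SL (k + 1)) := (D.S.uL k).mul (D.S.uL k)
    have uRR : IsUnit (SR (k + 1) * SR (k + 1)) := (D.S.uR k).mul (D.S.uR k)
    refine ⟨fun j hj => ?_, fun j hj hjk => ?_, ?_⟩
    · refine unit_cancel_left uLL ?_
      rw [IX, i1 (j + 1) (by omega), i2 (j + 1) (by omega) (by omega)]
      simp
    · refine unit_cancel_left uRR ?_
      rw [IY, i1 j (by omega), i2 j (by omega) (by omega)]
      simp
    · have h := IY 0
      rw [i1 0 (by omega)] at h
      simp only [pow_zero, star_one, one_smul] at h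
      rw [i3, Matrix.mul_zero, sub_zero, Matrix.mul_assoc] at h
      have h2 := (D.S.uR k).mul_left_cancel h
      have h3 := D.S.recY k 0
      rw [zero_smul, add_zero] at h3
      have h4 : (Y k 0)ᴴ = (Y (k + 1) 0)ᴴ * SR (k + 1) := by
        rw [← h3, Matrix.conjTranspose_mul, D.S.hR]
      have hu := (Matrix.isUnit_iff_isUnit_det _).1 (D.uY k (z := 0) (by simp))
      have hu' := (Matrix.isUnit_iff_isUnit_det _).1 (D.uY (k + 1) (z := 0) (by simp))
      have h5 : (Y k 0)ᴴ * matInt tau (fun θ => Y k (ee θ) * w Y n θ) = 1 := by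
        rw [h4, Matrix.mul_assoc, h2, ← Matrix.conjTranspose_mul, Matrix.nonsing_inv_mul _ hu',
          Matrix.conjTranspose_one]
      rw [Matrix.conjTranspose_nonsing_inv]
      exact (Matrix.inv_eq_right_inv h5).symm

lemma mom_zero_V (D : Dat μs V N X Y Xt a b H SL SR) :
    (b 0 0)ᴴ * b 0 0 * matInt (tau + μs) V = 1 := by
  have h := D.orX 0 0
  simp only [D.X0, if_true] at h
  rw [matInt_mul_const _ (D.miV.const_mul _), matInt_const_mul _ D.miV] at h
  have h2 := D.S.init 0
  rw [D.X0, D.Y0] at h2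
  rw [← h2, Matrix.mul_assoc]
  exact mul_eq_one_comm.1 h

lemma mom_zero_w (D : Dat μs V N X Y Xt a b H SL SR) (n : ℕ) :
    (b 0 0)ᴴ * b 0 0 * matInt tau (w Y n) = 1 := by
  have h := (D.desc n n 0 (by omega)).2.2
  have hu := (Matrix.isUnit_iff_isUnit_det _).1 (D.uY 0 (z := 0) (by simp))
  simp only [D.Y0] at h hu
  rw [matInt_const_mul _ (D.w_bc n).MI] at h
  rw [Matrix.mul_assoc, h, ← Matrix.conjTranspose_mul, Matrix.nonsing_inv_mul _ hu,
    Matrix.conjTranspose_one]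

lemma moments (D : Dat μs V N X Y Xt a b H SL SR) (n k : ℕ) (hk : k ≤ n) :
    matInt tau (fun θ => ee θ ^ k • w Y n θ) = matInt (tau + μs) (fun θ => ee θ ^ k • V θ) := by
  refine moments_unique (n := n) D.ua (M := fun k => matInt tau (fun θ => ee θ ^ k • w Y n θ))
    (M' := fun k => matInt (tau + μs) (fun θ => ee θ ^ k • V θ)) ?_ ?_ ?_ k hk
  · simp only [pow_zero, one_smul]
    have h1 := D.mom_zero_w n
    have h2 := D.mom_zero_V
    rw [← Matrix.inv_eq_right_inv h1, ← Matrix.inv_eq_right_inv h2]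
  · intro k hk1 hkn
    have h := (D.desc n (n - k) k (by omega)).1 0 (by omega)
    simp only [pow_zero, star_one, one_smul, D.hX k] at h
    rw [matInt_poly_mul (D.w_bc n).MI] at h
    exact h
  · intro k hk1 hkn
    have h := D.orth_pow (k - 1) 0 (by omega)
    rw [Nat.sub_add_cancel hk1] at h
    simp only [pow_zero, star_one, one_smul, D.hX k] at h
    rw [matInt_poly_mul D.miV] at h
    exact h

end Dat
end


section
variable {p : ℕ}

lemma bdF {μ : Measure ℝ} {F : ℝ → Matrix (Fin p) (Fin p) ℂ} (hF : MI μ F)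
    (hp : ∀ θ, (F θ).PosSemidef) {g : ℝ → ℂ} {c : ℝ} (hg : ∀ θ, ‖g θ‖ ≤ c) (i j : Fin p) :
    ‖∫ θ, g θ * F θ i j ∂μ‖ ≤ c * (matInt μ F).trace.re := by
  have h1 : Integrable (fun θ => c * (F θ).trace.re) μ := (hF.trace.re).const_mul c
  have h2 : ∫ θ, c * (F θ).trace.re ∂μ = c * (matInt μ F).trace.re := by
    rw [integral_const_mul, matInt_trace hF]
    congr 1
    exact integral_re hF.trace
  rw [← h2]
  refine norm_integral_le_of_norm_le h1 (Eventually.of_forall fun θ => ?_)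
  rw [norm_mul]
  exact mul_le_mul (hg θ) (psd_entry_le (hp θ) i j) (norm_nonneg _) ((norm_nonneg _).trans (hg θ))

abbrev CC := C(AddCircle (2 * Real.pi), ℂ)

instance fact2pi : Fact (0 < 2 * Real.pi) := ⟨by positivity⟩

lemma CC_cont (f : CC) : Continuous (fun θ : ℝ => f (θ : AddCircle (2 * Real.pi))) :=
  f.continuous.comp (AddCircle.continuous_mk' _)

lemma fourier_ee_nat (k : ℕ) (θ : ℝ) :
    (fourier (k : ℤ) : CC) (θ : AddCircle (2 * Real.pi)) = ee θ ^ k := by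
  rw [fourier_coe_apply, ← Complex.exp_nat_mul]
  congr 1
  have : (Real.pi : ℂ) ≠ 0 := by exact_mod_cast Real.pi_ne_zero
  push_cast
  field_simp

lemma fourier_ee_neg (k : ℕ) (θ : ℝ) :
    (fourier (-(k : ℤ)) : CC) (θ : AddCircle (2 * Real.pi)) = star (ee θ ^ k) := by
  rw [fourier_neg, fourier_ee_nat]; rfl

variable {μs : Measure ℝ} {V : ℝ → Matrix (Fin p) (Fin p) ℂ} {N : Set ℝ}
    {X Y Xt : ℕ → ℂ → Matrix (Fin p) (Fin p) ℂ} {a b : ℕ → ℕ → Matrix (Fin p) (Fin p) ℂ}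
    {H SL SR : ℕ → Matrix (Fin p) (Fin p) ℂ}

namespace Dat

lemma w_psd (n : ℕ) (θ : ℝ) : (w Y n θ).PosSemidef := Matrix.posSemidef_self_mul_conjTranspose _

lemma moments_neg (D : Dat μs V N X Y Xt a b H SL SR) (n k : ℕ) (hk : k ≤ n) :
    matInt tau (fun θ => star (ee θ ^ k) • w Y n θ) =
      matInt (tau + μs) (fun θ => star (ee θ ^ k) • V θ) := by
  have h := congrArg Matrix.conjTranspose (D.moments n k hk)
  rw [← matInt_star, ← matInt_star] at h
  simp only [Matrix.conjTranspose_smul] at h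
  have e1 : ∀ θ, (w Y n θ)ᴴ = w Y n θ := fun θ => (w_psd n θ).1
  have e2 : ∀ θ, (V θ)ᴴ = V θ := fun θ => (D.psd θ).1
  simp only [e1, e2] at h
  exact h

lemma tendsto_fourier (D : Dat μs V N X Y Xt a b H SL SR) (k : ℤ) (i j : Fin p) :
    Tendsto (fun n => ∫ θ, (fourier k : CC) (θ : AddCircle (2 * Real.pi)) * w Y n θ i j ∂tau) atTop
      (𝓝 (∫ θ, (fourier k : CC) (θ : AddCircle (2 * Real.pi)) * V θ i j ∂(tau + μs))) := by
  refine tendsto_const_nhds.congr' ?_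
  filter_upwards [eventually_ge_atTop k.natAbs] with n hn
  rcases Int.natAbs_eq k with hk | hk
  · rw [hk]
    simp only [fourier_ee_nat]
    have := congrFun (congrFun (D.moments n k.natAbs hn) i) j
    simpa [matInt] using this.symm
  · rw [hk]
    simp only [fourier_ee_neg]
    have := congrFun (congrFun (D.moments_neg n k.natAbs hn) i) j
    simpa [matInt] using this.symm

lemma int_w (D : Dat μs V N X Y Xt a b H SL SR) (f : CC) (n : ℕ) (i j : Fin p) :
    Integrable (fun θ : ℝ => f (θ : AddCircle (2 * Real.pi)) * w Y n θ i j) tau :=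
  ((D.w_bc n).MI i j).bdd_mul (c := ‖f‖) (CC_cont f).aestronglyMeasurable
    (Eventually.of_forall fun _ => f.norm_coe_le_norm _)

lemma int_V (D : Dat μs V N X Y Xt a b H SL SR) (f : CC) (i j : Fin p) :
    Integrable (fun θ : ℝ => f (θ : AddCircle (2 * Real.pi)) * V θ i j) (tau + μs) :=
  (D.miV i j).bdd_mul (c := ‖f‖) (CC_cont f).aestronglyMeasurable
    (Eventually.of_forall fun _ => f.norm_coe_le_norm _)

lemma weak (D : Dat μs V N X Y Xt a b H SL SR) (f : CC) (i j : Fin p) :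
    Tendsto (fun n => ∫ θ, f (θ : AddCircle (2 * Real.pi)) * w Y n θ i j ∂tau) atTop
      (𝓝 (∫ θ, f (θ : AddCircle (2 * Real.pi)) * V θ i j ∂(tau + μs))) := by
  have hspan : ∀ g ∈ Submodule.span ℂ (Set.range (@fourier (2 * Real.pi))),
      Tendsto (fun n => ∫ θ, g (θ : AddCircle (2 * Real.pi)) * w Y n θ i j ∂tau) atTop
      (𝓝 (∫ θ, g (θ : AddCircle (2 * Real.pi)) * V θ i j ∂(tau + μs))) := by
    intro g hg
    induction hg using Submodule.span_induction with
    | mem g hg => obtain ⟨k, rfl⟩ := hg; exact D.tendsto_fourier k i j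
    | zero => simp
    | add g h _ _ ihg ihh =>
      have := ihg.add ihh
      simp only [ContinuousMap.add_apply, add_mul]
      rw [integral_add (D.int_V g i j) (D.int_V h i j)]
      refine this.congr fun n => ?_
      rw [integral_add (D.int_w g n i j) (D.int_w h n i j)]
    | smul c g _ ihg =>
      have := ihg.const_mul c
      simp only [ContinuousMap.smul_apply, smul_eq_mul, mul_assoc]
      rw [integral_const_mul]
      refine this.congr fun n => ?_
      rw [integral_const_mul]
  set T : ℝ := (matInt (tau + μs) V).trace.re with hT
  have hT0 : 0 ≤ T := by
    rw [hT, matInt_trace D.miV]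
    have : (∫ θ, (V θ).trace ∂(tau + μs)).re = ∫ θ, (V θ).trace.re ∂(tau + μs) :=
      (integral_re D.miV.trace).symm
    rw [this]
    exact integral_nonneg fun θ => psd_trace_nonneg (D.psd θ)
  have hTn : ∀ n, (matInt tau (w Y n)).trace.re = T := fun n => by
    have := D.moments n 0 (by omega)
    simp only [pow_zero, one_smul] at this
    rw [hT, ← this]
  rw [Metric.tendsto_atTop]
  intro ε hε
  have hf : f ∈ closure (Submodule.span ℂ (Set.range (@fourier (2 * Real.pi))) : Set CC) := by
    have h := @span_fourier_closure_eq_top (2 * Real.pi) _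
    have : f ∈ (Submodule.span ℂ (Set.range (@fourier (2 * Real.pi)))).topologicalClosure := by
      rw [h]; trivial
    exact this
  obtain ⟨g, hg, hfg⟩ := Metric.mem_closure_iff.1 hf (ε / (4 * (T + 1))) (by positivity)
  obtain ⟨n0, hn0⟩ := Metric.tendsto_atTop.1 (hspan g hg) (ε / 4) (by positivity)
  refine ⟨n0, fun n hn => ?_⟩
  have hb : ∀ x : AddCircle (2 * Real.pi), ‖f x - g x‖ ≤ ε / (4 * (T + 1)) := fun x => by
    rw [← dist_eq_norm]
    exact (ContinuousMap.dist_apply_le_dist x).trans hfg.le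
  have b1 := bdF (D.w_bc n).MI (w_psd n) (g := fun θ : ℝ => f θ - g θ) (fun θ => hb θ) i j (μ := tau)
  have b2 := bdF D.miV D.psd (g := fun θ : ℝ => f θ - g θ) (fun θ => hb θ) i j
  simp only [sub_mul] at b1 b2
  rw [integral_sub (D.int_w f n i j) (D.int_w g n i j), hTn] at b1
  rw [integral_sub (D.int_V f i j) (D.int_V g i j)] at b2
  have b3 := hn0 n hn
  rw [dist_eq_norm] at b3 ⊢
  have hsm : ε / (4 * (T + 1)) * T ≤ ε / 4 := by
    rw [div_mul_eq_mul_div, div_le_div_iff₀ (by positivity) (by norm_num)]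
    nlinarith
  set A := ∫ θ, f (θ : AddCircle (2 * Real.pi)) * w Y n θ i j ∂tau
  set B := ∫ θ, g (θ : AddCircle (2 * Real.pi)) * w Y n θ i j ∂tau
  set A' := ∫ θ, f (θ : AddCircle (2 * Real.pi)) * V θ i j ∂(tau + μs)
  set B' := ∫ θ, g (θ : AddCircle (2 * Real.pi)) * V θ i j ∂(tau + μs)
  have : A - A' = (A - B) + (B - B') - (A' - B') := by ring
  rw [this]
  calc _ ≤ ‖A - B‖ + ‖B - B'‖ + ‖A' - B'‖ := (norm_sub_le _ _).trans (by gcongr; exact norm_add_le _ _)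
    _ < ε := by linarith

end Dat
end


section

noncomputable def clip (C : ℝ) (z : ℂ) : ℂ := ((C / max C ‖z‖ : ℝ) : ℂ) * z

lemma clip_cont {C : ℝ} (hC : 0 < C) : Continuous (clip C) := by
  unfold clip
  refine Continuous.mul (Complex.continuous_ofReal.comp ?_) continuous_id
  refine continuous_const.div (by fun_prop) fun z => ?_
  exact (lt_of_lt_of_le hC (le_max_left _ _)).ne'

lemma clip_norm {C : ℝ} (hC : 0 < C) (z : ℂ) : ‖clip C z‖ ≤ C := by
  have h := lt_of_lt_of_le hC (le_max_left C ‖z‖)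
  rw [clip, norm_mul, Complex.norm_real, Real.norm_eq_abs, abs_of_nonneg (by positivity),
    div_mul_eq_mul_div, div_le_iff₀ h]
  exact mul_le_mul_of_nonneg_left (le_max_right _ _) hC.le

lemma clip_eq {C : ℝ} (hC : 0 < C) {z : ℂ} (hz : ‖z‖ ≤ C) : clip C z = z := by
  rw [clip, max_eq_left hz, div_self hC.ne']; simp

lemma approx_cont (ν : Measure ℝ) [IsFiniteMeasure ν]
    (hν : ν (Set.Ico (0:ℝ) (2 * Real.pi))ᶜ = 0) {f : ℝ → ℂ} (hf : AEStronglyMeasurable f ν)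
    {C : ℝ} (hC : 0 < C) (hfC : ∀ θ, ‖f θ‖ ≤ C) :
    ∃ g : ℕ → CC, (∀ k x, ‖g k x‖ ≤ C) ∧
      ∀ᵐ (θ : ℝ) ∂ν, Tendsto (fun k => g k (θ : AddCircle (2 * Real.pi))) atTop (𝓝 (f θ)) := by
  set f0 := hf.mk f with hf0
  have mf0 : StronglyMeasurable f0 := hf.stronglyMeasurable_mk
  have ef0 : f =ᵐ[ν] f0 := hf.ae_eq_mk
  have mco : Measurable (fun θ : ℝ => (θ : AddCircle (2 * Real.pi))) :=
    (AddCircle.continuous_mk' _).measurable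
  set ν' : Measure (AddCircle (2 * Real.pi)) := ν.map (fun θ : ℝ => (θ : AddCircle (2 * Real.pi)))
  have : IsFiniteMeasure ν' := Measure.isFiniteMeasure_map _ _
  set E := AddCircle.measurableEquivIco (2 * Real.pi) 0
  set f' : AddCircle (2 * Real.pi) → ℂ := fun x => f0 (E x : ℝ) with hf'
  have mf' : Measurable f' := mf0.measurable.comp (measurable_subtype_coe.comp E.measurable)
  have hE : ∀ θ ∈ Set.Ico (0:ℝ) (2 * Real.pi), f' (θ : AddCircle (2 * Real.pi)) = f0 θ := by
    intro θ hθ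
    have h : θ ∈ Set.Ico (0:ℝ) (0 + 2 * Real.pi) := by simpa using hθ
    have : (E (θ : AddCircle (2 * Real.pi)) : ℝ) = θ :=
      congrArg Subtype.val (AddCircle.equivIco_coe_eq h)
    simp only [hf', this]
  have aeI : ∀ᵐ θ ∂ν, θ ∈ Set.Ico (0:ℝ) (2 * Real.pi) := by
    rw [ae_iff]; exact hν
  have aef : ∀ᵐ (θ : ℝ) ∂ν, f' (θ : AddCircle (2 * Real.pi)) = f θ := by
    filter_upwards [aeI, ef0] with θ h1 h2
    rw [hE θ h1, h2]
  have bf' : ∀ᵐ x ∂ν', ‖f' x‖ ≤ C := by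
    rw [ae_map_iff mco.aemeasurable (measurableSet_le mf'.norm measurable_const)]
    filter_upwards [aef] with θ h
    rw [h]; exact hfC θ
  have hm : MemLp f' 1 ν' := MemLp.of_bound mf'.aestronglyMeasurable C bf'
  have hex : ∀ k : ℕ, ∃ g : BoundedContinuousFunction (AddCircle (2 * Real.pi)) ℂ,
      eLpNorm (f' - (g : AddCircle (2 * Real.pi) → ℂ)) 1 ν' ≤ ENNReal.ofReal (1 / ((k:ℝ) + 1)) := by
    intro k
    obtain ⟨g, hg, _⟩ := hm.exists_boundedContinuous_eLpNorm_sub_le ENNReal.one_ne_top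
      (ε := ENNReal.ofReal (1 / ((k:ℝ) + 1))) (by
        rw [Ne, ENNReal.ofReal_eq_zero, not_le]; positivity)
    exact ⟨g, hg⟩
  choose g hg using hex
  have ht : Tendsto (fun k => eLpNorm ((g k : AddCircle (2 * Real.pi) → ℂ) - f') 1 ν') atTop
      (𝓝 0) := by
    have h0 : Tendsto (fun k : ℕ => ENNReal.ofReal (1 / ((k:ℝ) + 1))) atTop (𝓝 0) := by
      rw [← ENNReal.ofReal_zero]
      exact ENNReal.tendsto_ofReal tendsto_one_div_add_atTop_nhds_zero_nat
    refine tendsto_of_tendsto_of_tendsto_of_le_of_le tendsto_const_nhds h0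
      (fun _ => zero_le) fun k => ?_
    rw [eLpNorm_sub_comm]
    exact hg k
  have him := tendstoInMeasure_of_tendsto_eLpNorm one_ne_zero
    (fun k => (g k).continuous.aestronglyMeasurable) mf'.aestronglyMeasurable ht
  obtain ⟨ns, -, hns⟩ := him.exists_seq_tendsto_ae
  refine ⟨fun k => ⟨fun x => clip C (g (ns k) x), (clip_cont hC).comp (g (ns k)).continuous⟩,
    fun k x => clip_norm hC _, ?_⟩
  filter_upwards [aef, ae_of_ae_map mco.aemeasurable hns] with θ h1 h2
  rw [h1] at h2
  have := ((clip_cont hC).tendsto (f θ)).comp h2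
  rw [clip_eq hC (hfC θ)] at this
  exact this

lemma tau_Ico : tau (Set.Ico (0:ℝ) (2 * Real.pi))ᶜ = 0 := by
  rw [tau, ← Measure.restrict_congr_set Ico_ae_eq_Ioc, Measure.smul_apply,
    Measure.restrict_apply (measurableSet_Ico.compl), Set.compl_inter_self, measure_empty,
    smul_zero]
end


section
variable {p : ℕ}

lemma posDef_shift {A : Matrix (Fin p) (Fin p) ℂ} (hA : A.PosSemidef) {ε : ℝ} (hε : 0 < ε) :
    (A + (ε : ℂ) • (1 : Matrix (Fin p) (Fin p) ℂ)).PosDef :=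
  Matrix.PosDef.posSemidef_add hA (Matrix.PosDef.one.smul (by exact_mod_cast hε))

open scoped MatrixOrder Matrix.Norms.L2Operator in
lemma exists_Phi {ε : ℝ} (hε : 0 < ε) :
    ∃ Φ : Matrix (Fin p) (Fin p) ℂ → Matrix (Fin p) (Fin p) ℂ, Continuous Φ ∧
      ∀ A, A.PosSemidef → Φ A * (A + (ε : ℂ) • (1 : Matrix (Fin p) (Fin p) ℂ)) * (Φ A)ᴴ = 1 := by
  have hpos : ∀ A : Matrix (Fin p) (Fin p) ℂ,
      (CFC.abs A + (ε : ℂ) • (1 : Matrix (Fin p) (Fin p) ℂ)).PosDef := fun A =>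
    posDef_shift (Matrix.nonneg_iff_posSemidef.1 (CFC.abs_nonneg A)) hε
  refine ⟨fun A => CFC.sqrt (CFC.abs (Ring.inverse
    (CFC.abs A + (ε : ℂ) • (1 : Matrix (Fin p) (Fin p) ℂ)))), ?_, ?_⟩
  · have h1 : Continuous (fun A : Matrix (Fin p) (Fin p) ℂ => CFC.sqrt (CFC.abs A)) :=
      CFC.continuousOn_sqrt.comp_continuous CFC.continuous_abs (fun A => CFC.abs_nonneg A)
    refine h1.comp ?_
    have h2 : Continuous (fun A : Matrix (Fin p) (Fin p) ℂ =>
        CFC.abs A + (ε : ℂ) • (1 : Matrix (Fin p) (Fin p) ℂ)) :=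
      CFC.continuous_abs.add continuous_const
    rw [continuous_iff_continuousAt]
    intro A
    obtain ⟨u, hu⟩ := (hpos A).isUnit
    have h3 := NormedRing.inverse_continuousAt u
    rw [hu] at h3
    exact ContinuousAt.comp (f := fun A : Matrix (Fin p) (Fin p) ℂ =>
        CFC.abs A + (ε : ℂ) • (1 : Matrix (Fin p) (Fin p) ℂ)) h3 h2.continuousAt
  · intro A hA
    have e1 : CFC.abs A = A := CFC.abs_of_nonneg A (Matrix.nonneg_iff_posSemidef.2 hA)
    have hp := hpos A
    simp only [e1] at hp ⊢
    set B := A + (ε : ℂ) • (1 : Matrix (Fin p) (Fin p) ℂ) with hB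
    have hBi : (Ring.inverse B).PosSemidef := by
      rw [← Matrix.nonsing_inv_eq_ringInverse]; exact hp.inv.posSemidef
    have hBi' := Matrix.nonneg_iff_posSemidef.2 hBi
    rw [CFC.abs_of_nonneg _ hBi']
    set R := CFC.sqrt (Ring.inverse B) with hR
    have hRR : R * R = Ring.inverse B := CFC.sqrt_mul_sqrt_self _ hBi'
    have hRs : Rᴴ = R := (Matrix.nonneg_iff_posSemidef.1 (CFC.sqrt_nonneg (Ring.inverse B))).1
    rw [hRs, mul_eq_one_comm, ← Matrix.mul_assoc, hRR]
    exact Ring.inverse_mul_cancel _ hp.isUnit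

lemma entry_sq_le (R : Matrix (Fin p) (Fin p) ℂ) (i j : Fin p) :
    ‖R i j‖ ^ 2 ≤ (R * Rᴴ).trace.re := by
  have h : (R * Rᴴ).trace.re = ∑ i, ∑ j, ‖R i j‖ ^ 2 := by
    simp only [Matrix.trace, Matrix.diag, Matrix.mul_apply, Matrix.conjTranspose_apply,
      Complex.re_sum, Complex.star_def, Complex.mul_conj, Complex.normSq_eq_norm_sq,
      Complex.ofReal_re]
  rw [h]
  refine le_trans ?_ (Finset.single_le_sum (f := fun i => ∑ j, ‖R i j‖ ^ 2)
      (fun i _ => Finset.sum_nonneg fun j _ => by positivity) (Finset.mem_univ i))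
  exact Finset.single_le_sum (f := fun j => ‖R i j‖ ^ 2) (fun j _ => by positivity)
    (Finset.mem_univ j)

/-- facts on `R V Rᴴ` when `R (V+ε) Rᴴ = 1` -/
lemma Phi_facts {R V : Matrix (Fin p) (Fin p) ℂ} (hV : V.PosSemidef) {ε : ℝ} (hε : 0 < ε)
    (h : R * (V + (ε : ℂ) • (1 : Matrix (Fin p) (Fin p) ℂ)) * Rᴴ = 1) :
    (R * V * Rᴴ).trace.re ≤ p ∧ (∀ i j, ‖R i j‖ ≤ p / ε + 1) ∧
    (R * V * Rᴴ).det = V.det / (V + (ε : ℂ) • (1 : Matrix (Fin p) (Fin p) ℂ)).det := by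
  have e : R * V * Rᴴ = 1 - (ε : ℂ) • (R * Rᴴ) := by
    rw [← h]
    simp only [Matrix.mul_add, Matrix.add_mul, Matrix.mul_smul, Matrix.smul_mul, Matrix.mul_one]
    abel
  have e2 : (R * V * Rᴴ).trace.re = p - ε * (R * Rᴴ).trace.re := by
    rw [e, Matrix.trace_sub, Matrix.trace_smul, Matrix.trace_one]
    simp
  have h1 : 0 ≤ (R * V * Rᴴ).trace.re := psd_trace_nonneg (hV.mul_mul_conjTranspose_same R)
  have h2 : 0 ≤ (R * Rᴴ).trace.re := psd_trace_nonneg (Matrix.posSemidef_self_mul_conjTranspose R)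
  refine ⟨?_, fun i j => ?_, ?_⟩
  · rw [e2]; nlinarith
  · have h3 : (R * Rᴴ).trace.re ≤ p / ε := by
      rw [le_div_iff₀ hε]; nlinarith
    have h4 := (entry_sq_le R i j).trans h3
    nlinarith [sq_nonneg (‖R i j‖ - 1), norm_nonneg (R i j)]
  · have hd := congrArg Matrix.det h
    rw [Matrix.det_mul, Matrix.det_mul, Matrix.det_one] at hd
    have hne : (V + (ε : ℂ) • (1 : Matrix (Fin p) (Fin p) ℂ)).det ≠ 0 := by
      intro h0; rw [h0] at hd; simp at hd
    rw [Matrix.det_mul, Matrix.det_mul, eq_div_iff hne]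
    linear_combination V.det * hd

lemma det_rpow_le_one (hp : 0 < p) {A : Matrix (Fin p) (Fin p) ℂ} (hA : A.PosSemidef) {c : ℝ}
    (h : A.trace.re ≤ c) : A.det.re ^ ((3 * p : ℝ)⁻¹) ≤ 1 + c := by
  have h0 := psd_det_re_nonneg hA
  have h1 := psd_amgm hp hA
  have hp' : (1:ℝ) ≤ p := by exact_mod_cast hp
  set x := A.det.re ^ ((p:ℝ)⁻¹) with hx
  have hx0 : 0 ≤ x := Real.rpow_nonneg h0 _
  have e : A.det.re ^ ((3 * p : ℝ)⁻¹) = x ^ ((3:ℝ)⁻¹) := by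
    rw [hx, ← Real.rpow_mul h0]; congr 1; rw [mul_inv]; ring
  have hxc : x ≤ c := by nlinarith
  rw [e]
  rcases le_total x 1 with h2 | h2
  · have := Real.rpow_le_one hx0 h2 (by norm_num : (0:ℝ) ≤ (3:ℝ)⁻¹)
    linarith
  · have : x ^ ((3:ℝ)⁻¹) ≤ x ^ (1:ℝ) := Real.rpow_le_rpow_of_exponent_le h2 (by norm_num)
    rw [Real.rpow_one] at this
    linarith

lemma trace_bound {G V : Matrix (Fin p) (Fin p) ℂ} (hV : V.PosSemidef) {C : ℝ}
    (hG : ∀ i j, ‖G i j‖ ≤ C) :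
    (G * V * Gᴴ).trace.re ≤ (p:ℝ) ^ 3 * C ^ 2 * V.trace.re := by
  have e : (G * V * Gᴴ).trace = ∑ i, ∑ k, (∑ j, G i j * V j k) * star (G i k) := by
    simp only [Matrix.trace, Matrix.diag, Matrix.mul_apply, Matrix.conjTranspose_apply]
  have ht := psd_trace_nonneg hV
  refine (Complex.re_le_norm _).trans ?_
  rw [e]
  have : (p:ℝ) ^ 3 * C ^ 2 * V.trace.re =
      ∑ _i : Fin p, ∑ _k : Fin p, (∑ _j : Fin p, C * V.trace.re) * C := by
    simp only [Finset.sum_const, Finset.card_univ, Fintype.card_fin, nsmul_eq_mul]; ring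
  rw [this]
  refine (norm_sum_le _ _).trans (Finset.sum_le_sum fun i _ => ?_)
  refine (norm_sum_le _ _).trans (Finset.sum_le_sum fun k _ => ?_)
  rw [norm_mul, norm_star]
  have hC : 0 ≤ C := (norm_nonneg _).trans (hG i k)
  refine mul_le_mul ?_ (hG i k) (norm_nonneg _) (Finset.sum_nonneg fun _ _ => by positivity)
  refine (norm_sum_le _ _).trans (Finset.sum_le_sum fun j _ => ?_)
  rw [norm_mul]
  exact mul_le_mul (hG i j) (psd_entry_le hV j k) (norm_nonneg _) hC

noncomputable def dF (V G : ℝ → Matrix (Fin p) (Fin p) ℂ) (θ : ℝ) : ℝ :=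
  (G θ * V θ * (G θ)ᴴ).det.re ^ ((3 * p : ℝ)⁻¹)
noncomputable def tF (V G : ℝ → Matrix (Fin p) (Fin p) ℂ) (θ : ℝ) : ℝ :=
  (G θ * V θ * (G θ)ᴴ).trace.re

noncomputable def JJ (μs : Measure ℝ) (V G : ℝ → Matrix (Fin p) (Fin p) ℂ) : ℝ :=
  (3 / 2) * ∫ θ, dF V G θ ∂tau - (2 * p : ℝ)⁻¹ * ∫ θ, tF V G θ ∂(tau + μs)

lemma asm_of_entries {μ : Measure ℝ} {F : ℝ → Matrix (Fin p) (Fin p) ℂ}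
    (h : ∀ i j, AEStronglyMeasurable (fun θ => F θ i j) μ) : AEStronglyMeasurable F μ := by
  have : F = fun θ => ∑ i, ∑ j, F θ i j • Matrix.single i j (1:ℂ) := by
    funext z
    conv_lhs => rw [matrix_eq_sum_single (F z)]
    simp
  rw [this]
  refine Finset.aestronglyMeasurable_fun_sum _ fun i _ =>
    Finset.aestronglyMeasurable_fun_sum _ fun j _ => ?_
  exact (h i j).smul aestronglyMeasurable_const

lemma asm_quad {μ : Measure ℝ} {F G : ℝ → Matrix (Fin p) (Fin p) ℂ}
    (hF : AEStronglyMeasurable F μ) (hG : AEStronglyMeasurable G μ) :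
    AEStronglyMeasurable (fun θ => G θ * F θ * (G θ)ᴴ) μ := by
  have hc : Continuous (fun q : Matrix (Fin p) (Fin p) ℂ × Matrix (Fin p) (Fin p) ℂ =>
      q.2 * q.1 * (q.2)ᴴ) :=
    (continuous_snd.matrix_mul continuous_fst).matrix_mul continuous_snd.matrix_conjTranspose
  exact Continuous.comp_aestronglyMeasurable
    (g := fun q : Matrix (Fin p) (Fin p) ℂ × Matrix (Fin p) (Fin p) ℂ => q.2 * q.1 * (q.2)ᴴ)
    (f := fun θ => (F θ, G θ)) hc (hF.prodMk hG)

lemma asm_dF {μ : Measure ℝ} {F G : ℝ → Matrix (Fin p) (Fin p) ℂ}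
    (hF : AEStronglyMeasurable F μ) (hG : AEStronglyMeasurable G μ) :
    AEStronglyMeasurable (dF F G) μ := by
  have hc : Continuous (fun M : Matrix (Fin p) (Fin p) ℂ => M.det.re ^ ((3 * p : ℝ)⁻¹)) :=
    (Complex.continuous_re.comp continuous_id.matrix_det).rpow_const
      fun _ => Or.inr (by positivity)
  exact hc.comp_aestronglyMeasurable (asm_quad hF hG)

lemma asm_tF {μ : Measure ℝ} {F G : ℝ → Matrix (Fin p) (Fin p) ℂ}
    (hF : AEStronglyMeasurable F μ) (hG : AEStronglyMeasurable G μ) :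
    AEStronglyMeasurable (tF F G) μ := by
  have hc : Continuous (fun M : Matrix (Fin p) (Fin p) ℂ => M.trace.re) :=
    Complex.continuous_re.comp continuous_id.matrix_trace
  exact hc.comp_aestronglyMeasurable (asm_quad hF hG)

lemma JJ_cont (hp : 0 < p) {μs : Measure ℝ} [IsFiniteMeasure μs]
    {V R : ℝ → Matrix (Fin p) (Fin p) ℂ} (hV : ∀ θ, (V θ).PosSemidef) (mV : MI (tau + μs) V)
    {G : ℕ → ℝ → Matrix (Fin p) (Fin p) ℂ}
    (mG : ∀ k i j, AEStronglyMeasurable (fun θ => G k θ i j) (tau + μs)) {C : ℝ}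
    (hG : ∀ k θ i j, ‖G k θ i j‖ ≤ C)
    (hlim : ∀ i j, ∀ᵐ θ ∂(tau + μs), Tendsto (fun k => G k θ i j) atTop (𝓝 (R θ i j))) :
    Tendsto (fun k => JJ μs V (G k)) atTop (𝓝 (JJ μs V R)) := by
  have aT : tau ≪ tau + μs := (Measure.le_add_right le_rfl).absolutelyContinuous
  have mG' : ∀ k, AEStronglyMeasurable (G k) (tau + μs) := fun k => asm_of_entries (mG k)
  have mV' : AEStronglyMeasurable V (tau + μs) := asm_of_entries fun i j => (mV i j).1
  have hlim' : ∀ᵐ θ ∂(tau + μs), Tendsto (fun k => G k θ * V θ * (G k θ)ᴴ) atTop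
      (𝓝 (R θ * V θ * (R θ)ᴴ)) := by
    have : ∀ᵐ θ ∂(tau + μs), ∀ i j, Tendsto (fun k => G k θ i j) atTop (𝓝 (R θ i j)) :=
      ae_all_iff.2 fun i => ae_all_iff.2 fun j => hlim i j
    filter_upwards [this] with θ hθ
    have h1 : Tendsto (fun k => G k θ) atTop (𝓝 (R θ)) :=
      tendsto_pi_nhds.2 fun i => tendsto_pi_nhds.2 fun j => hθ i j
    have hc : Continuous (fun M : Matrix (Fin p) (Fin p) ℂ => M * V θ * Mᴴ) :=
      (continuous_id.matrix_mul continuous_const).matrix_mul continuous_id.matrix_conjTranspose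
    exact (hc.tendsto (R θ)).comp h1
  set bd : ℝ → ℝ := fun θ => (p:ℝ) ^ 3 * C ^ 2 * (V θ).trace.re with hbd
  have ibd : Integrable bd (tau + μs) := (mV.trace.re).const_mul _
  have ibdT : Integrable bd tau := ibd.mono_measure (Measure.le_add_right le_rfl)
  unfold JJ
  refine Tendsto.sub (Tendsto.const_mul _ ?_) (Tendsto.const_mul _ ?_)
  · refine tendsto_integral_of_dominated_convergence (fun θ => 1 + bd θ)
      (fun k => (asm_dF mV' (mG' k)).mono_ac aT) ((integrable_const 1).add ibdT)
      (fun k => Eventually.of_forall fun θ => ?_) ?_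
    · have hps := (hV θ).mul_mul_conjTranspose_same (G k θ)
      rw [dF, Real.norm_eq_abs, abs_of_nonneg (Real.rpow_nonneg (psd_det_re_nonneg hps) _)]
      exact det_rpow_le_one hp hps (trace_bound (hV θ) (hG k θ))
    · filter_upwards [aT.ae_le hlim'] with θ hθ
      have hc : Continuous (fun M : Matrix (Fin p) (Fin p) ℂ => M.det.re ^ ((3 * p : ℝ)⁻¹)) :=
        (Complex.continuous_re.comp continuous_id.matrix_det).rpow_const
          fun _ => Or.inr (by positivity)
      exact (hc.tendsto _).comp hθ
  · refine tendsto_integral_of_dominated_convergence bd (fun k => asm_tF mV' (mG' k)) ibd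
      (fun k => Eventually.of_forall fun θ => ?_) ?_
    · have hps := (hV θ).mul_mul_conjTranspose_same (G k θ)
      rw [tF, Real.norm_eq_abs, abs_of_nonneg (psd_trace_nonneg hps)]
      exact trace_bound (hV θ) (hG k θ)
    · filter_upwards [hlim'] with θ hθ
      have hc : Continuous (fun M : Matrix (Fin p) (Fin p) ℂ => M.trace.re) :=
        Complex.continuous_re.comp continuous_id.matrix_trace
      exact (hc.tendsto _).comp hθ

end


section
variable {p : ℕ} {μs : Measure ℝ} {V : ℝ → Matrix (Fin p) (Fin p) ℂ} {N : Set ℝ}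
    {X Y Xt : ℕ → ℂ → Matrix (Fin p) (Fin p) ℂ} {a b : ℕ → ℕ → Matrix (Fin p) (Fin p) ℂ}
    {H SL SR : ℕ → Matrix (Fin p) (Fin p) ℂ}

noncomputable def Gm (g : Fin p → Fin p → CC) (θ : ℝ) : Matrix (Fin p) (Fin p) ℂ :=
  Matrix.of fun i j => g i j (θ : AddCircle (2 * Real.pi))

lemma Gm_bc (g : Fin p → Fin p → CC) : BC (Gm g) := by
  refine ⟨continuous_matrix fun i j => CC_cont (g i j), ∑ i, ∑ j, ‖g i j‖, fun θ i j => ?_⟩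
  have h1 : ‖Gm g θ i j‖ ≤ ‖g i j‖ := (g i j).norm_coe_le_norm _
  refine h1.trans ?_
  refine le_trans ?_ (Finset.single_le_sum (f := fun i => ∑ j, ‖g i j‖)
      (fun i _ => Finset.sum_nonneg fun j _ => norm_nonneg _) (Finset.mem_univ i))
  exact Finset.single_le_sum (f := fun j => ‖g i j‖) (fun j _ => norm_nonneg _) (Finset.mem_univ j)

namespace Dat

lemma exists_R (D : Dat μs V N X Y Xt a b H SL SR) (hp : 0 < p) {δ : ℝ} (hδ : 0 < δ) :
    ∃ (R : ℝ → Matrix (Fin p) (Fin p) ℂ) (C : ℝ), 0 < C ∧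
      (∀ i j, AEStronglyMeasurable (fun θ => R θ i j) (tau + μs)) ∧
      (∀ θ i j, ‖R θ i j‖ ≤ C) ∧ 1 - δ < JJ μs V R := by
  classical
  have := D.fin
  have hp' : (0:ℝ) < p := by exact_mod_cast hp
  have hεm : ∀ m : ℕ, (0:ℝ) < 1 / ((m:ℝ) + 1) := fun m => by positivity
  choose Φ hΦc hΦ using fun m : ℕ => exists_Phi (p := p) (hεm m)
  set R : ℕ → ℝ → Matrix (Fin p) (Fin p) ℂ := fun m θ => Nᶜ.indicator (fun θ => Φ m (V θ)) θ with hR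
  have mV' : AEStronglyMeasurable V (tau + μs) := asm_of_entries fun i j => (D.miV i j).1
  have mR : ∀ m, AEStronglyMeasurable (R m) (tau + μs) := fun m =>
    ((hΦc m).comp_aestronglyMeasurable mV').indicator D.mN.compl
  have aT : tau ≪ tau + μs := (Measure.le_add_right le_rfl).absolutelyContinuous
  have R1 : ∀ m θ, θ ∉ N → R m θ = Φ m (V θ) := fun m θ h => by
    simp only [hR]; exact Set.indicator_of_mem h _
  have R0 : ∀ m θ, θ ∈ N → R m θ = 0 := fun m θ h => by
    simp only [hR]; exact Set.indicator_of_notMem (by simpa using h) _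
  have ft := fun m θ => Phi_facts (D.psd θ) (hεm m) (hΦ m _ (D.psd θ))
  have htr : ∀ m θ, tF V (R m) θ ≤ Nᶜ.indicator (fun _ => (p:ℝ)) θ := by
    intro m θ
    by_cases h : θ ∈ N
    · rw [tF, R0 m θ h, Set.indicator_of_notMem (by simpa using h)]; simp
    · rw [tF, R1 m θ h, Set.indicator_of_mem h]; exact (ft m θ).1
  have htr' : ∀ m θ, tF V (R m) θ ≤ p := fun m θ =>
    (htr m θ).trans (Set.indicator_le_self' (fun _ _ => hp'.le) θ)
  have htr0 : ∀ m θ, 0 ≤ tF V (R m) θ := fun m θ =>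
    psd_trace_nonneg ((D.psd θ).mul_mul_conjTranspose_same _)
  have i2 : ∀ m, ∫ θ, tF V (R m) θ ∂(tau + μs) ≤ p := by
    intro m
    have h1 : ∫ θ, tF V (R m) θ ∂(tau + μs) ≤ ∫ θ, Nᶜ.indicator (fun _ => (p:ℝ)) θ ∂(tau + μs) :=
      integral_mono_of_nonneg (Eventually.of_forall (htr0 m))
        ((integrable_const _).indicator D.mN.compl) (Eventually.of_forall (htr m))
    refine h1.trans ?_
    rw [integral_indicator_const _ D.mN.compl, Measure.real, Measure.add_apply, D.sN, add_zero,
      (prob_compl_eq_one_iff D.mN).2 D.tN]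
    simp
  have i1 : Tendsto (fun m => ∫ θ, dF V (R m) θ ∂tau) atTop (𝓝 1) := by
    have e : (1:ℝ) = ∫ _θ, (1:ℝ) ∂tau := by simp
    rw [e]
    refine tendsto_integral_of_dominated_convergence (fun _ => 1 + (p:ℝ))
      (fun m => (asm_dF mV' (mR m)).mono_ac aT) (integrable_const _)
      (fun m => Eventually.of_forall fun θ => ?_) ?_
    · have hps := (D.psd θ).mul_mul_conjTranspose_same (R m θ)
      rw [dF, Real.norm_eq_abs, abs_of_nonneg (Real.rpow_nonneg (psd_det_re_nonneg hps) _)]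
      exact det_rpow_le_one hp hps (htr' m θ)
    · have hn : ∀ᵐ θ ∂tau, θ ∉ N := measure_eq_zero_iff_ae_notMem.1 D.tN
      filter_upwards [hn, D.det] with θ h1 h2
      have hd : (V θ).det ≠ 0 := by intro h; rw [h] at h2; simp at h2
      have hε0 : Tendsto (fun m : ℕ => ((1 / ((m:ℝ) + 1) : ℝ) : ℂ)) atTop (𝓝 ((0:ℝ):ℂ)) :=
        (Complex.continuous_ofReal.tendsto 0).comp tendsto_one_div_add_atTop_nhds_zero_nat
      have hc : Continuous (fun t : ℂ => (V θ + t • (1 : Matrix (Fin p) (Fin p) ℂ)).det) := by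
        refine Continuous.matrix_det ?_
        exact continuous_const.add (continuous_id.smul continuous_const)
      have h3 := (hc.tendsto _).comp hε0
      simp only [Complex.ofReal_zero, zero_smul, add_zero] at h3
      have h4 : Tendsto (fun m => (R m θ * V θ * (R m θ)ᴴ).det) atTop (𝓝 1) := by
        have h5 := (tendsto_const_nhds (x := (V θ).det) (f := (atTop : Filter ℕ))).div h3 hd
        rw [div_self hd] at h5
        refine h5.congr fun m => ?_
        rw [R1 m θ h1, (ft m θ).2.2]; rfl
      have h6 := ((Complex.continuous_re.rpow_const
        (fun _ => Or.inr (by positivity : (0:ℝ) ≤ (3 * p : ℝ)⁻¹))).tendsto (1:ℂ)).comp h4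
      simp only [Complex.one_re, Real.one_rpow] at h6
      exact h6
  have hev := i1.eventually (lt_mem_nhds (show 1 - δ / 2 < 1 by linarith))
  obtain ⟨m, hm⟩ := hev.exists
  refine ⟨R m, p / (1 / ((m:ℝ) + 1)) + 1, by positivity, fun i j => ?_, fun θ i j => ?_, ?_⟩
  · exact Continuous.comp_aestronglyMeasurable (g := fun M : Matrix (Fin p) (Fin p) ℂ => M i j)
      (continuous_id.matrix_elem i j) (mR m)
  · by_cases h : θ ∈ N
    · rw [R0 m θ h]; simp only [Matrix.zero_apply, norm_zero]; positivity
    · rw [R1 m θ h]; exact (ft m θ).2.1 i j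
  · have h2 := i2 m
    have h3 : (2 * p : ℝ)⁻¹ * ∫ θ, tF V (R m) θ ∂(tau + μs) ≤ 1 / 2 := by
      calc _ ≤ (2 * p : ℝ)⁻¹ * p := by gcongr
        _ = 1 / 2 := by field_simp
    unfold JJ
    linarith

lemma exists_G (D : Dat μs V N X Y Xt a b H SL SR) (hp : 0 < p) {δ : ℝ} (hδ : 0 < δ) :
    ∃ g : Fin p → Fin p → CC, 1 - δ < JJ μs V (Gm g) := by
  have := D.fin
  obtain ⟨R, C, hC, mR, bR, hJ⟩ := D.exists_R hp hδ
  have hν : (tau + μs) (Set.Ico (0:ℝ) (2 * Real.pi))ᶜ = 0 := by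
    rw [Measure.add_apply, tau_Ico, D.supp, add_zero]
  choose g hg hlim using fun i j => approx_cont (tau + μs) hν (mR i j) hC (fun θ => bR θ i j)
  have ht := JJ_cont hp D.psd D.miV (R := R) (G := fun k => Gm (fun i j => g i j k))
    (fun k i j => (CC_cont (g i j k)).aestronglyMeasurable) (fun k θ i j => hg i j k _) hlim
  obtain ⟨k, hk⟩ := (ht.eventually (lt_mem_nhds hJ)).exists
  exact ⟨_, hk⟩

lemma tF_sum {μ : Measure ℝ} {F : ℝ → Matrix (Fin p) (Fin p) ℂ} (hF : MI μ F)
    (g : Fin p → Fin p → CC) :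
    ∫ θ, tF F (Gm g) θ ∂μ = (∑ i, ∑ k, ∑ j,
      ∫ θ, (g i j * star (g i k)) (θ : AddCircle (2 * Real.pi)) * F θ j k ∂μ).re := by
  have hm : MI μ (fun θ => Gm g θ * F θ * (Gm g θ)ᴴ) := (Gm_bc g).star.mul_MI ((Gm_bc g).MI_mul hF)
  have h1 : ∫ θ, tF F (Gm g) θ ∂μ = (∫ θ, (Gm g θ * F θ * (Gm g θ)ᴴ).trace ∂μ).re :=
    integral_re hm.trace
  rw [h1]
  congr 1
  have hi : ∀ i j k, Integrable
      (fun θ : ℝ => (g i j * star (g i k)) (θ : AddCircle (2 * Real.pi)) * F θ j k) μ :=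
    fun i j k => (hF j k).bdd_mul (c := ‖g i j * star (g i k)‖) (CC_cont _).aestronglyMeasurable
      (Eventually.of_forall fun _ => ContinuousMap.norm_coe_le_norm _ _)
  have e : ∀ θ, (Gm g θ * F θ * (Gm g θ)ᴴ).trace = ∑ i, ∑ k, ∑ j,
      (g i j * star (g i k)) (θ : AddCircle (2 * Real.pi)) * F θ j k := by
    intro θ
    simp only [Matrix.trace, Matrix.diag, Matrix.mul_apply, Matrix.conjTranspose_apply,
      Finset.sum_mul]
    refine Finset.sum_congr rfl fun i _ => Finset.sum_congr rfl fun k _ =>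
      Finset.sum_congr rfl fun j _ => ?_
    simp only [Gm, Matrix.of_apply, ContinuousMap.mul_apply, ContinuousMap.star_apply]
    ring
  simp only [e]
  rw [integral_finsetSum _ fun i _ => integrable_finsetSum _ fun k _ =>
    integrable_finsetSum _ fun j _ => hi i j k]
  refine Finset.sum_congr rfl fun i _ => ?_
  rw [integral_finsetSum _ fun k _ => integrable_finsetSum _ fun j _ => hi i j k]
  refine Finset.sum_congr rfl fun k _ => ?_
  rw [integral_finsetSum _ fun j _ => hi i j k]

lemma tF_tendsto (D : Dat μs V N X Y Xt a b H SL SR) (g : Fin p → Fin p → CC) :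
    Tendsto (fun n => ∫ θ, tF (w Y n) (Gm g) θ ∂tau) atTop
      (𝓝 (∫ θ, tF V (Gm g) θ ∂(tau + μs))) := by
  rw [tF_sum D.miV]
  simp only [fun n => tF_sum (μ := tau) (D.w_bc n).MI g]
  refine (Complex.continuous_re.tendsto _).comp ?_
  exact tendsto_finsetSum _ fun i _ => tendsto_finsetSum _ fun k _ => tendsto_finsetSum _ fun j _ =>
    D.weak _ j k

/-- `Y V Yᴴ` -/
noncomputable def A (V : ℝ → Matrix (Fin p) (Fin p) ℂ) (Y : ℕ → ℂ → Matrix (Fin p) (Fin p) ℂ)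
    (n : ℕ) (θ : ℝ) : Matrix (Fin p) (Fin p) ℂ := Y n (ee θ) * V θ * (Y n (ee θ))ᴴ

noncomputable def q (V : ℝ → Matrix (Fin p) (Fin p) ℂ) (Y : ℕ → ℂ → Matrix (Fin p) (Fin p) ℂ)
    (n : ℕ) (θ : ℝ) : ℝ := (A V Y n θ).det.re ^ ((2 * p : ℝ)⁻¹)

lemma A_psd (D : Dat μs V N X Y Xt a b H SL SR) (n : ℕ) (θ : ℝ) : (A V Y n θ).PosSemidef :=
  (D.psd θ).mul_mul_conjTranspose_same _

lemma A_mi (D : Dat μs V N X Y Xt a b H SL SR) (n : ℕ) : MI (tau + μs) (A V Y n) :=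
  (D.hdY n).bc.star.mul_MI ((D.hdY n).bc.MI_mul D.miV)
lemma A_miT (D : Dat μs V N X Y Xt a b H SL SR) (n : ℕ) : MI tau (A V Y n) :=
  (D.hdY n).bc.star.mul_MI ((D.hdY n).bc.MI_mul D.miT)
lemma A_miS (D : Dat μs V N X Y Xt a b H SL SR) (n : ℕ) : MI μs (A V Y n) :=
  (D.hdY n).bc.star.mul_MI ((D.hdY n).bc.MI_mul D.miS)

lemma q_int (D : Dat μs V N X Y Xt a b H SL SR) (hp : 0 < p) (n : ℕ) :
    Integrable (q V Y n) tau := by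
  have hp' : (1:ℝ) ≤ p := by exact_mod_cast hp
  have hA : AEStronglyMeasurable (A V Y n) tau := asm_of_entries fun i j => (D.A_miT n i j).1
  have hc : Continuous (fun M : Matrix (Fin p) (Fin p) ℂ => M.det.re ^ ((2 * p : ℝ)⁻¹)) :=
    (Complex.continuous_re.comp continuous_id.matrix_det).rpow_const
      fun _ => Or.inr (by positivity)
  refine Integrable.mono' (g := fun θ => (A V Y n θ).trace.re + p)
    (((D.A_miT n).trace.re).add (integrable_const _)) (hc.comp_aestronglyMeasurable hA)
    (Eventually.of_forall fun θ => ?_)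
  have h1 := psd_defect_nonneg hp (D.A_psd n θ)
  have h2 : 0 ≤ q V Y n θ := Real.rpow_nonneg (psd_det_re_nonneg (D.A_psd n θ)) _
  rw [Real.norm_eq_abs, abs_of_nonneg h2]
  change 0 ≤ (A V Y n θ).trace.re + p - 2 * p * q V Y n θ at h1
  nlinarith

lemma q_lower (D : Dat μs V N X Y Xt a b H SL SR) (hp : 0 < p) (n : ℕ) (g : Fin p → Fin p → CC) :
    (3 / 2) * ∫ θ, dF V (Gm g) θ ∂tau - (2 * p : ℝ)⁻¹ * ∫ θ, tF (w Y n) (Gm g) θ ∂tau ≤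
      ∫ θ, q V Y n θ ∂tau := by
  have hG := Gm_bc g
  have i1 : Integrable (tF V (Gm g)) tau :=
    (MI.trace (hG.star.mul_MI (hG.MI_mul D.miT))).re
  have i2 : Integrable (tF (w Y n) (Gm g)) tau :=
    (MI.trace (hG.star.mul_MI (hG.MI_mul (D.w_bc n).MI))).re
  have i3 : Integrable (dF V (Gm g)) tau := by
    refine Integrable.mono' (g := fun θ => 1 + tF V (Gm g) θ) ((integrable_const _).add i1)
      (asm_dF (asm_of_entries fun i j => (D.miT i j).1) (asm_of_entries fun i j => (hG.cont i j).aestronglyMeasurable))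
      (Eventually.of_forall fun θ => ?_)
    have hps := (D.psd θ).mul_mul_conjTranspose_same (Gm g θ)
    rw [dF, Real.norm_eq_abs, abs_of_nonneg (Real.rpow_nonneg (psd_det_re_nonneg hps) _)]
    exact det_rpow_le_one hp hps le_rfl
  rw [← integral_const_mul, ← integral_const_mul, ← integral_sub (i3.const_mul _) (i2.const_mul _)]
  refine integral_mono ((i3.const_mul _).sub (i2.const_mul _)) (D.q_int hp n) fun θ => ?_
  have hu := (Matrix.isUnit_iff_isUnit_det _).1 (D.uY n (ee_norm θ).le)
  set B : Matrix (Fin p) (Fin p) ℂ := (Gm g θ * (Y n (ee θ))⁻¹)ᴴ * (Gm g θ * (Y n (ee θ))⁻¹) with hB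
  have hBp : B.PosSemidef := Matrix.posSemidef_conjTranspose_mul_self _
  have h := holder_lin hp hBp (psd_det_re_nonneg (D.A_psd n θ))
  have e1 : B.trace.re = tF (w Y n) (Gm g) θ := by
    rw [tF, hB, Matrix.trace_mul_comm, Matrix.conjTranspose_mul, w]
    simp only [Matrix.mul_assoc]
  have e2 : (A V Y n θ).det.re * B.det.re = (Gm g θ * V θ * (Gm g θ)ᴴ).det.re := by
    have him : B.det.im = 0 := by
      have := hBp.det_nonneg
      exact ((Complex.le_def.1 this).2).symm
    have : (A V Y n θ).det * B.det = (Gm g θ * V θ * (Gm g θ)ᴴ).det := by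
      rw [A, hB]
      simp only [Matrix.det_mul, Matrix.det_conjTranspose, star_mul', Matrix.det_nonsing_inv,
        Ring.inverse_eq_inv']
      have hy : (Y n (ee θ)).det ≠ 0 := hu.ne_zero
      have hy' : star (Y n (ee θ)).det ≠ 0 := star_ne_zero.2 hy
      rw [star_inv₀]
      field_simp
    rw [← this, Complex.mul_re, him]; ring
  rw [e1, e2] at h
  exact h

lemma q_event (D : Dat μs V N X Y Xt a b H SL SR) (hp : 0 < p) {δ : ℝ} (hδ : 0 < δ) :
    ∀ᶠ n in atTop, 1 - δ < ∫ θ, q V Y n θ ∂tau := by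
  obtain ⟨g, hg⟩ := D.exists_G hp hδ
  have ht := ((D.tF_tendsto g).const_mul ((2 * p : ℝ)⁻¹)).const_sub
    ((3 / 2) * ∫ θ, dF V (Gm g) θ ∂tau)
  filter_upwards [ht.eventually (lt_mem_nhds hg)] with n hn
  exact hn.trans_le (D.q_lower hp n g)

end Dat
end


section
variable {p : ℕ} {μs : Measure ℝ} {V : ℝ → Matrix (Fin p) (Fin p) ℂ} {N : Set ℝ}
  {X Y Xt : ℕ → ℂ → Matrix (Fin p) (Fin p) ℂ} {a b : ℕ → ℕ → Matrix (Fin p) (Fin p) ℂ}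
  {H SL SR : ℕ → Matrix (Fin p) (Fin p) ℂ}

lemma matInt_entry_bound {μ : Measure ℝ} {U B : ℝ → Matrix (Fin p) (Fin p) ℂ} {g : ℝ → ℝ}
    (hU : ∀ θ i j, ‖U θ i j‖ ≤ 1) (hB : ∀ θ i j, ‖B θ i j‖ ≤ g θ) (hg : Integrable g μ)
    (i j : Fin p) : ‖matInt μ (fun θ => U θ * B θ) i j‖ ≤ p * ∫ θ, g θ ∂μ := by
  rw [← integral_const_mul]
  refine norm_integral_le_of_norm_le (hg.const_mul _) (Eventually.of_forall fun θ => ?_)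
  change ‖(U θ * B θ) i j‖ ≤ p * g θ
  rw [Matrix.mul_apply]
  refine (norm_sum_le _ _).trans ?_
  have : ∀ k ∈ (Finset.univ : Finset (Fin p)), ‖U θ i k * B θ k j‖ ≤ g θ := fun k _ => by
    rw [norm_mul]
    exact (mul_le_of_le_one_left (norm_nonneg _) (hU θ i k)).trans (hB θ k j)
  refine (Finset.sum_le_sum this).trans ?_
  simp

namespace Dat

lemma H_split (D : Dat μs V N X Y Xt a b H SL SR) (n : ℕ) :
    -H (n + 1) = matInt tau (fun θ => (ee θ • (X n (ee θ) * (Y n (ee θ))⁻¹)) * (A V Y n θ - 1)) +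
      matInt μs (fun θ => (ee θ • (X n (ee θ) * (Y n (ee θ))⁻¹)) * A V Y n θ) := by
  have hd := (D.hdX n).mul (D.hdYi n)
  have hU : BC (fun θ => ee θ • (X n (ee θ) * (Y n (ee θ))⁻¹)) :=
    hd.bc.smul ee_cont fun θ => (ee_norm θ).le
  have h0 : matInt tau (fun θ => ee θ • (X n (ee θ) * (Y n (ee θ))⁻¹)) = 0 := by
    have := hd.mv_zero (le_refl 1)
    simpa only [pow_one] using this
  have e : matInt tau (fun θ => (ee θ • (X n (ee θ) * (Y n (ee θ))⁻¹)) * (A V Y n θ - 1)) =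
      matInt tau (fun θ => (ee θ • (X n (ee θ) * (Y n (ee θ))⁻¹)) * A V Y n θ) := by
    rw [← sub_zero (matInt tau (fun θ => (ee θ • (X n (ee θ) * (Y n (ee θ))⁻¹)) * A V Y n θ)),
      ← h0, ← matInt_sub (hU.MI_mul (D.A_miT n)) hU.MI]
    exact matInt_congr fun θ => by rw [Matrix.mul_sub, Matrix.mul_one]
  rw [e, ← matInt_add_measure (hU.MI_mul (D.A_miT n)) (hU.MI_mul (D.A_miS n))]
  exact D.H_formula n

lemma trace_split (D : Dat μs V N X Y Xt a b H SL SR) (n : ℕ) :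
    (p : ℝ) = ∫ θ, (A V Y n θ).trace.re ∂tau + ∫ θ, (A V Y n θ).trace.re ∂μs := by
  have h : matInt (tau + μs) (A V Y n) = 1 := D.orY n
  have h2 := matInt_trace (D.A_mi n)
  rw [h, Matrix.trace_one, Fintype.card_fin] at h2
  have iT := (D.A_miT n).trace
  have iS := (D.A_miS n).trace
  rw [integral_add_measure iT iS] at h2
  have h3 := congrArg Complex.re h2
  rw [Complex.natCast_re, Complex.add_re] at h3
  have e1 : (∫ θ, (A V Y n θ).trace ∂tau).re = ∫ θ, (A V Y n θ).trace.re ∂tau :=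
    (integral_re iT).symm
  have e2 : (∫ θ, (A V Y n θ).trace ∂μs).re = ∫ θ, (A V Y n θ).trace.re ∂μs :=
    (integral_re iS).symm
  rw [e1, e2] at h3
  exact h3

lemma entry_event (D : Dat μs V N X Y Xt a b H SL SR) (hp : 0 < p) {ε : ℝ} (hε : 0 < ε) :
    ∀ᶠ n in atTop, ∀ i j, ‖H (n + 1) i j‖ ≤ p * (p * (3 * ε + 2 * ε ^ 2)) := by
  have hδ : 0 < ε ^ 2 := by positivity
  filter_upwards [D.q_event hp hδ] with n hn i j
  have hp' : (0 : ℝ) < p := by exact_mod_cast hp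
  have hUe : ∀ θ i j, ‖(ee θ • (X n (ee θ) * (Y n (ee θ))⁻¹)) i j‖ ≤ 1 := fun θ i j => by
    rw [Matrix.smul_apply, norm_smul, ee_norm, one_mul]
    exact D.S.U_entry (ee_norm θ) n i j
  have iT : Integrable (fun θ => (A V Y n θ).trace.re) tau := (D.A_miT n).trace.re
  have iS : Integrable (fun θ => (A V Y n θ).trace.re) μs := (D.A_miS n).trace.re
  have iq := D.q_int hp n
  have itr := D.trace_split n
  set T := ∫ θ, (A V Y n θ).trace.re ∂tau with hT
  set S := ∫ θ, (A V Y n θ).trace.re ∂μs with hS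
  set Q := ∫ θ, q V Y n θ ∂tau with hQ
  have iD : Integrable (fun θ => (A V Y n θ).trace.re + p - 2 * p * q V Y n θ) tau :=
    (iT.add (integrable_const _)).sub (iq.const_mul _)
  have iP : Integrable (fun θ => (A V Y n θ).trace.re + (p : ℝ)) tau :=
    iT.add (integrable_const _)
  have eP : ∫ θ, ((A V Y n θ).trace.re + (p : ℝ)) ∂tau = T + p := by
    rw [integral_add iT (integrable_const _)]; simp [hT]
  have eD : ∫ θ, ((A V Y n θ).trace.re + p - 2 * p * q V Y n θ) ∂tau = T + p - 2 * p * Q := by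
    rw [integral_sub iP (iq.const_mul _), eP, integral_const_mul]
  have hD0 : 0 ≤ T + p - 2 * p * Q := by
    rw [← eD]
    exact integral_nonneg fun θ => psd_defect_nonneg hp (D.A_psd n θ)
  have hS0 : 0 ≤ S := integral_nonneg fun θ => psd_trace_nonneg (D.A_psd n θ)
  have b1 := matInt_entry_bound (μ := tau) (B := fun θ => A V Y n θ - 1)
    (g := fun θ => (2 * ε)⁻¹ * ((A V Y n θ).trace.re + p - 2 * p * q V Y n θ) +
      ε * ((A V Y n θ).trace.re + p)) hUe
    (fun θ i j => psd_sub_one_entry hp (D.A_psd n θ) hε i j)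
    ((iD.const_mul _).add (iP.const_mul _)) i j
  rw [integral_add (iD.const_mul _) (iP.const_mul _), integral_const_mul, integral_const_mul,
    eD, eP] at b1
  have b2 := matInt_entry_bound (μ := μs) (B := A V Y n)
    (g := fun θ => (A V Y n θ).trace.re) hUe
    (fun θ i j => psd_entry_le (D.A_psd n θ) i j) iS i j
  rw [← hS] at b2
  have hpQ : p * (1 - Q) ≤ p * ε ^ 2 := mul_le_mul_of_nonneg_left (by linarith) hp'.le
  have c1 : (2 * ε)⁻¹ * (T + p - 2 * p * Q) ≤ p * ε := by
    rw [inv_mul_le_iff₀ (by positivity)]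
    nlinarith
  have c2 : ε * (T + p) ≤ 2 * p * ε := by nlinarith
  have c3 : S ≤ 2 * p * ε ^ 2 := by nlinarith
  have hH : ‖H (n + 1) i j‖ = ‖(-H (n + 1)) i j‖ := by rw [Matrix.neg_apply, norm_neg]
  rw [hH, D.H_split n, Matrix.add_apply]
  refine (norm_add_le _ _).trans ((add_le_add b1 b2).trans ?_)
  rw [← mul_add]
  refine mul_le_mul_of_nonneg_left ?_ hp'.le
  linarith

lemma entry_tendsto (D : Dat μs V N X Y Xt a b H SL SR) (hp : 0 < p) (i j : Fin p) :
    Tendsto (fun n => H (n + 1) i j) atTop (𝓝 0) := by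
  rw [Metric.tendsto_atTop']
  intro r hr
  have hc : Tendsto (fun ε : ℝ => (p : ℝ) * (p * (3 * ε + 2 * ε ^ 2))) (𝓝[>] 0) (𝓝 0) := by
    have : Continuous (fun ε : ℝ => (p : ℝ) * (p * (3 * ε + 2 * ε ^ 2))) := by fun_prop
    have h := this.tendsto 0
    simp only [mul_zero, ne_eq, OfNat.ofNat_ne_zero, not_false_eq_true, zero_pow, add_zero] at h
    exact h.mono_left nhdsWithin_le_nhds
  obtain ⟨ε, hε, hε0⟩ := ((hc.eventually (gt_mem_nhds hr)).and self_mem_nhdsWithin).exists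
  obtain ⟨n0, hn0⟩ := eventually_atTop.1 (D.entry_event hp (Set.mem_Ioi.1 hε0))
  refine ⟨n0, fun n hn => ?_⟩
  rw [dist_zero_right]
  exact (hn0 n hn.le i j).trans_lt hε

end Dat

open scoped Matrix.Norms.L2Operator in
lemma sNorm_tendsto (h : ∀ i j, Tendsto (fun n => H (n + 1) i j) atTop (𝓝 0)) :
    Tendsto (fun m => sNorm (H m)) atTop (𝓝 0) := by
  rw [← tendsto_add_atTop_iff_nat 1]
  have h1 : Tendsto (fun n => H (n + 1)) atTop (𝓝 0) :=
    tendsto_pi_nhds.2 fun i => tendsto_pi_nhds.2 fun j => h i j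
  simp only [sNorm_eq]
  exact tendsto_zero_iff_norm_tendsto_zero.1 h1

end


/-- **Rakhmanov's theorem for orthogonal matrix polynomials.**
Let `ρ` be a `p×p` positive matrix measure on the unit circle with Lebesgue
decomposition `dρ = W'(θ) dθ/2π + dρ_s` (here the singular part is `ρ_s = Ws dμs`
with `μs` singular with respect to Lebesgue measure), and let `φ_n^L, φ_n^R` be the
left and right orthonormal matrix polynomials with reflection coefficients `H_n`
from the matrix Szegő recurrences.  If `det W'(θ) > 0` for almost every
`θ ∈ [0,2π)`, then `lim_{n→∞} H_n = 0`. -/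
theorem rakhmanov_matrix_opuc
    (p : ℕ)
    (W' : ℝ → Matrix (Fin p) (Fin p) ℂ)
    (hW' : ∀ θ, (W' θ).PosSemidef)
    (hW'int : ∀ i j, IntervalIntegrable (fun θ => W' θ i j)
      MeasureTheory.volume 0 (2 * Real.pi))
    (μs : Measure ℝ) [IsFiniteMeasure μs]
    (hsupp : μs (Set.Ico (0:ℝ) (2 * Real.pi))ᶜ = 0)
    (hsing : μs ⟂ₘ (MeasureTheory.volume : Measure ℝ))
    (Ws : ℝ → Matrix (Fin p) (Fin p) ℂ)
    (hWs : ∀ θ, (Ws θ).PosSemidef)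
    (hWsint : ∀ i j, Integrable (fun θ => Ws θ i j) μs)
    (aL aR : ℕ → ℕ → Matrix (Fin p) (Fin p) ℂ)
    (φL φR φLt φRt : ℕ → ℂ → Matrix (Fin p) (Fin p) ℂ)
    (hφL : ∀ m z, φL m z = ∑ j ∈ range (m + 1), z ^ j • aL m j)
    (hφR : ∀ m z, φR m z = ∑ j ∈ range (m + 1), z ^ j • aR m j)
    (hφLt : ∀ m z, φLt m z = ∑ j ∈ range (m + 1), z ^ (m - j) • (aL m j)ᴴ)
    (hφRt : ∀ m z, φRt m z = ∑ j ∈ range (m + 1), z ^ (m - j) • (aR m j)ᴴ)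
    (hLlead : ∀ m, IsUnit (aL m m)) (hRlead : ∀ m, IsUnit (aR m m))
    (horthL : ∀ k m,
      (2 * Real.pi : ℝ)⁻¹ • matIntI (fun θ =>
        φL k (Complex.exp (θ * Complex.I)) * W' θ *
          (φL m (Complex.exp (θ * Complex.I)))ᴴ) +
      matInt μs (fun θ =>
        φL k (Complex.exp (θ * Complex.I)) * Ws θ *
          (φL m (Complex.exp (θ * Complex.I)))ᴴ) = if k = m then 1 else 0)
    (horthR : ∀ k m,
      (2 * Real.pi : ℝ)⁻¹ • matIntI (fun θ =>
        (φR k (Complex.exp (θ * Complex.I)))ᴴ * W' θ *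
          φR m (Complex.exp (θ * Complex.I))) +
      matInt μs (fun θ =>
        (φR k (Complex.exp (θ * Complex.I)))ᴴ * Ws θ *
          φR m (Complex.exp (θ * Complex.I))) = if k = m then 1 else 0)
    (H SL SR : ℕ → Matrix (Fin p) (Fin p) ℂ)
    (hHnorm : ∀ m, 1 ≤ m → sNorm (H m) < 1)
    (hSLherm : ∀ m, (SL m)ᴴ = SL m) (hSRherm : ∀ m, (SR m)ᴴ = SR m)
    (hSLsq : ∀ m, SL m ^ 2 = 1 - H m * (H m)ᴴ)
    (hSRsq : ∀ m, SR m ^ 2 = 1 - (H m)ᴴ * H m)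
    (hrecL : ∀ m z, SL (m + 1) * φL (m + 1) z = z • φL m z + H (m + 1) * φRt m z)
    (hrecR : ∀ m z, φR (m + 1) z * SR (m + 1) = z • φR m z + φLt m z * H (m + 1))
    (hdet : ∀ᵐ θ ∂(MeasureTheory.volume.restrict (Set.Ico (0:ℝ) (2 * Real.pi))),
      0 < ((W' θ).det).re) :
    Tendsto (fun m => sNorm (H m)) atTop (𝓝 0) := by
  rcases Nat.eq_zero_or_pos p with hp | hp
  · subst hp
    exact sNorm_tendsto fun i => i.elim0
  · obtain ⟨V, N, D⟩ := mkDat W' hW' hW'int μs hsupp hsing Ws hWs hWsint aL aR φL φR φLt φRt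
      hφL hφR hφLt hφRt hLlead hRlead horthL horthR H SL SR hHnorm hSLherm hSRherm hSLsq hSRsq
      hrecL hrecR hdet
    exact sNorm_tendsto fun i j => D.entry_tendsto hp i j
end
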